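/- arXiv:1211.3949 — 2 statements merged into one kernel-verified Lean document; each statement's English description precedes it below -/
import Mathlib

section
/- For every subset Y of A_b that is order isomorphic to ℚ, there exists f ∈ C↑_sur(b^ω) such that Y_f = Y, where Y_f = {max f⁻¹(W_s) : s ∈ b^{<ω}} \ {max b^ω}. -/
noncomputable section
open Classical

/-- Lexicographic strict order on `ℕ → Fin b`. -/
def lexLT (b : ℕ) (x y : ℕ → Fin b) : Prop :=
  ∃ n, (∀ m, m < n → x m = y m) ∧ x n < y n

/-- Lexicographic order `≤_lex` on `ℕ → Fin b`. -/
def lexLE (b : ℕ) (x y : ℕ → Fin b) : Prop := x = y ∨ lexLT b x y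

def IsGreatestLex (b : ℕ) (S : Set (ℕ → Fin b)) (x : ℕ → Fin b) : Prop :=
  x ∈ S ∧ ∀ y ∈ S, lexLE b y x

def IsLeastLex (b : ℕ) (S : Set (ℕ → Fin b)) (x : ℕ → Fin b) : Prop :=
  x ∈ S ∧ ∀ y ∈ S, lexLE b x y

/-- `S` is an interval for the lexicographic order. -/
def LexInterval (b : ℕ) (S : Set (ℕ → Fin b)) : Prop :=
  ∀ x ∈ S, ∀ y ∈ S, ∀ z, lexLE b x z → lexLE b z y → z ∈ S

/-- The basic clopen set of sequences extending the finite sequence `s`. -/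
def W (b : ℕ) (s : List (Fin b)) : Set (ℕ → Fin b) :=
  {x | ∀ i, (hi : i < s.length) → x i = s.get ⟨i, hi⟩}

/-- Continuous nondecreasing surjections of `b^ω`, i.e. members of `C↑_sur(b^ω)`. -/
def CSur (b : ℕ) (f : (ℕ → Fin b) → (ℕ → Fin b)) : Prop :=
  Continuous f ∧ Function.Surjective f ∧ ∀ x y, lexLE b x y → lexLE b (f x) (f y)

/-- A filtering on `b^ω`. -/
def Filtering (b : ℕ) (U : List (Fin b) → Set (ℕ → Fin b)) : Prop :=
  (∀ s, (U s).Nonempty ∧ IsClopen (U s) ∧ LexInterval b (U s)) ∧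
  U [] = Set.univ ∧
  (∀ s, U s = ⋃ i : Fin b, U (s ++ [i])) ∧
  (∀ s, ∀ i j : Fin b, i ≠ j → Disjoint (U (s ++ [i])) (U (s ++ [j]))) ∧
  (∀ s, ∀ i j : Fin b, i < j → ∀ x y,
    IsGreatestLex b (U (s ++ [i])) x → IsGreatestLex b (U (s ++ [j])) y → lexLT b x y)

/-- `A_b`: sequences eventually equal to `b-1` (the top of `Fin b`), except the constant
top sequence (the lexicographic maximum of `b^ω`). -/
def AbSet (b : ℕ) : Set (ℕ → Fin b) :=
  {x | (∃ N, ∀ n, N ≤ n → ∀ j : Fin b, j ≤ x n) ∧ ¬ ∀ n, ∀ j : Fin b, j ≤ x n}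

/-- `Y` is order isomorphic to `ℚ` with respect to the lexicographic order. -/
def OrderIsoQ (b : ℕ) (Y : Set (ℕ → Fin b)) : Prop :=
  ∃ e : ℚ ≃ Y, ∀ p q : ℚ, p ≤ q ↔ lexLE b (e p).1 (e q).1

/-- `Y_f = {max f⁻¹(W_s) : s ∈ b^{<ω}} \ {max b^ω}`. -/
def Yset (b : ℕ) (f : (ℕ → Fin b) → (ℕ → Fin b)) : Set (ℕ → Fin b) :=
  {x | (∃ s : List (Fin b), IsGreatestLex b (f ⁻¹' W b s) x) ∧ ¬ ∀ n, ∀ j : Fin b, j ≤ x n}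

/-- The metric `ρ_b` on `b^ω`. -/
def rhoB (b : ℕ) (x y : ℕ → Fin b) : ℝ :=
  if h : x = y then 0 else (2 : ℝ) ^ (-(Nat.find (Function.ne_iff.mp h) : ℤ))

/-- The sup-metric `ρ_∞` on `C↑_sur(b^ω)`. -/
def rhoInf (b : ℕ) (f g : (ℕ → Fin b) → (ℕ → Fin b)) : ℝ :=
  ⨆ x, rhoB b (f x) (g x)

/-- `⌊log₂(1/ε)⌋ + 1`. -/
def kOf (ε : ℝ) : ℕ := ⌊Real.logb 2 (1 / ε)⌋₊ + 1

/-- The `l`-th odd tangent number `t_l = tan^{(2l-1)}(0)`. -/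
def oddTangent (l : ℕ) : ℝ := iteratedDeriv (2 * l - 1) Real.tan 0

/-- The lexicographically increasing enumeration of `b^k`: `sEnum b k hb i` is the
`i`-th element of `b^k` in lexicographic order (base-`b` digits, most significant first). -/
def sEnum (b k : ℕ) (hb : 0 < b) (i : ℕ) : List (Fin b) :=
  List.ofFn fun j : Fin k => (⟨i / b ^ (k - 1 - (j : ℕ)) % b, Nat.mod_lt _ hb⟩ : Fin b)

end


theorem absPart {L : Type*} [LinearOrder L] (hglb : ∀ S : Set L, ∃ g, IsGLB S g) (A : Set L)
    (hsucc : ∀ a ∈ A, ∃ s, a < s ∧ ∀ z, a < z → s ≤ z)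
    (sep : ∀ x y : L, x < y → ∃ a ∈ A, x ≤ a ∧ a < y)
    (φ : A → L) (hφ : StrictMono φ) (hφA : ∀ a, φ a ∈ A) :
    ∃ f : L → L, Monotone f ∧ Function.Surjective f ∧ (∀ x (a : A), f x ≤ a ↔ x ≤ φ a) ∧
      ∀ a : A, f (φ a) = a := by
  choose inf hinf using hglb
  let f : L → L := fun x => inf {c | ∃ a : A, (a : L) = c ∧ x ≤ φ a}
  have key : ∀ x (a : A), f x ≤ a ↔ x ≤ φ a := by
    intro x a
    constructor
    · intro h
      obtain ⟨s, hs, hs'⟩ := hsucc a a.2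
      by_contra hx
      have : s ≤ f x := by
        apply (hinf _).2
        rintro c ⟨a', rfl, ha'⟩
        apply hs'
        by_contra hc
        exact hx (ha'.trans (hφ.monotone (not_lt.1 hc)))
      exact absurd (hs.trans_le this) (not_lt.2 h)
    · intro h
      exact (hinf _).1 ⟨a, rfl, h⟩
  have ext : ∀ y z : L, (∀ a : A, y ≤ a ↔ z ≤ a) → y = z := by
    intro y z h
    rcases lt_trichotomy y z with h1 | h1 | h1
    · obtain ⟨a, ha, h2, h3⟩ := sep _ _ h1
      exact absurd ((h ⟨a, ha⟩).1 h2) (not_le.2 h3)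
    · exact h1
    · obtain ⟨a, ha, h2, h3⟩ := sep _ _ h1
      exact absurd ((h ⟨a, ha⟩).2 h2) (not_le.2 h3)
  refine ⟨f, ?_, ?_, key, ?_⟩
  · intro x y hxy
    by_contra h
    obtain ⟨a, ha, h2, h3⟩ := sep _ _ (not_le.1 h)
    have := (key x ⟨a, ha⟩).2 (hxy.trans ((key y ⟨a, ha⟩).1 h2))
    exact absurd this (not_le.2 h3)
  · intro z
    refine ⟨inf {c | ∃ a : A, φ a = c ∧ z ≤ a}, ?_⟩
    apply ext
    intro a
    rw [key]
    constructor
    · intro h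
      by_contra hz
      obtain ⟨s, hs, hs'⟩ := hsucc (φ a) (hφA a)
      have : s ≤ inf {c | ∃ a : A, φ a = c ∧ z ≤ a} := by
        apply (hinf _).2
        rintro c ⟨a', rfl, ha'⟩
        exact hs' _ (hφ (Subtype.coe_lt_coe.1 (lt_of_lt_of_le (not_le.1 hz) ha')))
      exact absurd (hs.trans_le this) (not_lt.2 h)
    · intro h
      exact (hinf _).1 ⟨a, rfl, h⟩
  · intro a
    apply ext
    intro a'
    rw [key]
    exact hφ.le_iff_le

abbrev LL (k : ℕ) : Type := Lex (ℕ → Fin (k + 2))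

theorem LL_lt {k : ℕ} {x y : LL k} : x < y ↔ ∃ n, (∀ m, m < n → x m = y m) ∧ x n < y n := Iff.rfl

theorem LL_lexLT {k : ℕ} (x y : ℕ → Fin (k + 2)) :
    lexLT (k + 2) x y ↔ (toLex x : LL k) < toLex y := Iff.rfl

theorem LL_lexLE {k : ℕ} (x y : ℕ → Fin (k + 2)) :
    lexLE (k + 2) x y ↔ (toLex x : LL k) ≤ toLex y := by
  rw [le_iff_eq_or_lt]; exact Iff.rfl

theorem LL_glb {k : ℕ} (S : Set (LL k)) : ∃ g, IsGLB S g := ⟨sInf S, isGLB_sInf S⟩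

def AA (k : ℕ) : Set (LL k) :=
  {x | (∃ N, ∀ n, N ≤ n → x n = Fin.last (k + 1)) ∧ ∃ n, x n < Fin.last (k + 1)}

theorem allTop {k : ℕ} (c : Fin (k + 2)) : (∀ j : Fin (k + 2), j ≤ c) ↔ c = Fin.last (k + 1) :=
  ⟨fun h => le_antisymm (Fin.le_last _) (h _), fun h j => h ▸ Fin.le_last j⟩

theorem mem_AA {k : ℕ} (x : ℕ → Fin (k + 2)) : x ∈ AbSet (k + 2) ↔ (toLex x : LL k) ∈ AA k := by
  unfold AbSet AA
  simp only [Set.mem_ofPred_eq, allTop, Pi.toLex_apply, not_forall, Fin.lt_last_iff_ne_last, ne_eq]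

/-- agree with `x` up to and including `n`, then top -/
def cut {k : ℕ} (n : ℕ) (x : LL k) : LL k :=
  toLex (fun i => if i ≤ n then x i else Fin.last (k + 1))

theorem cut_le {k : ℕ} (n : ℕ) (x : LL k) (i : ℕ) (h : i ≤ n) : cut n x i = x i := if_pos h
theorem cut_gt {k : ℕ} (n : ℕ) (x : LL k) (i : ℕ) (h : n < i) : cut n x i = Fin.last (k + 1) :=
  if_neg (not_le.2 h)

theorem le_cut {k : ℕ} (n : ℕ) (x : LL k) : x ≤ cut n x := by
  by_contra h
  obtain ⟨m, h1, h2⟩ := LL_lt.1 (not_le.1 h)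
  rcases le_or_gt m n with h3 | h3
  · rw [cut_le n x m h3] at h2; exact lt_irrefl _ h2
  · rw [cut_gt n x m h3] at h2; exact absurd h2 (not_lt.2 (Fin.le_last _))

theorem cut_mem {k : ℕ} (n : ℕ) (x : LL k) (h : ∃ m ≤ n, x m < Fin.last (k + 1)) :
    cut n x ∈ AA k := by
  obtain ⟨m, hm, h⟩ := h
  exact ⟨⟨n + 1, fun i hi => cut_gt n x i hi⟩, m, by rwa [cut_le n x m hm]⟩

theorem cut_sep {k : ℕ} {x y : LL k} {n : ℕ} (h : ∀ m, m < n → x m = y m) (hn : x n < y n) :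
    cut n x ∈ AA k ∧ cut n x < y :=
  ⟨cut_mem n x ⟨n, le_rfl, hn.trans_le (Fin.le_last _)⟩,
    LL_lt.2 ⟨n, fun m hm => by rw [cut_le n x m hm.le, h m hm], by rwa [cut_le n x n le_rfl]⟩⟩

theorem AA_sep {k : ℕ} (x y : LL k) (h : x < y) : ∃ a ∈ AA k, x ≤ a ∧ a < y := by
  obtain ⟨n, h1, h2⟩ := LL_lt.1 h
  exact ⟨cut n x, (cut_sep h1 h2).1, le_cut n x, (cut_sep h1 h2).2⟩

theorem AA_succ {k : ℕ} (a : LL k) (ha : a ∈ AA k) : ∃ s, a < s ∧ ∀ z, a < z → s ≤ z := by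
  obtain ⟨hN, n0, hn0⟩ := ha
  classical
  have hf := Nat.find_spec hN
  have hmin : ∀ m, m < Nat.find hN → ¬ ∀ n, m ≤ n → a n = Fin.last (k + 1) :=
    fun m hm => Nat.find_min hN hm
  generalize Nat.find hN = N at hf hmin
  rcases N with _ | n
  · exact absurd (hf n0 (Nat.zero_le _)) hn0.ne
  have han : a n < Fin.last (k + 1) := by
    apply lt_of_le_of_ne (Fin.le_last _)
    intro h
    apply hmin n (Nat.lt_succ_self n)
    intro i hi
    rcases hi.eq_or_lt with rfl | h'
    · exact h
    · exact hf i h'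
  let s : LL k := toLex (fun i => if i < n then a i else if i = n then a n + 1 else 0)
  have s1 : ∀ i, i < n → s i = a i := fun i hi => if_pos hi
  have s2 : s n = a n + 1 := by
    change (if n < n then a n else if n = n then a n + 1 else 0) = _
    simp
  have s3 : ∀ i, n < i → s i = 0 := by
    intro i hi
    change (if i < n then a i else if i = n then a n + 1 else 0) = _
    rw [if_neg (by omega), if_neg (by omega)]
  refine ⟨s, LL_lt.2 ⟨n, fun m hm => (s1 m hm).symm, ?_⟩, ?_⟩
  · rw [s2]; exact Fin.lt_add_one_iff.2 han
  · intro z hz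
    obtain ⟨m, h1, h2⟩ := LL_lt.1 hz
    have hmn : m ≤ n := by
      by_contra h
      rw [hf m (by omega)] at h2
      exact absurd h2 (not_lt.2 (Fin.le_last _))
    rcases hmn.lt_or_eq with h | rfl
    · exact le_of_lt (LL_lt.2 ⟨m, fun i hi => by rw [s1 i (by omega), h1 i hi], by rwa [s1 m h]⟩)
    · by_contra hc
      obtain ⟨i, h3, h4⟩ := LL_lt.1 (not_le.1 hc)
      rcases lt_trichotomy i m with h | rfl | h
      · rw [s1 i h, h1 i h] at h4; exact lt_irrefl _ h4
      · rw [s2] at h4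
        exact absurd (Fin.add_one_le_of_lt h2) (not_le.2 h4)
      · rw [s3 i h] at h4; exact absurd h4 (Fin.not_lt_zero _)

theorem AA_below {k : ℕ} (a : LL k) (ha : ∃ N, ∀ n, N ≤ n → a n = Fin.last (k + 1)) (n : ℕ) :
    ∃ c ∈ AA k, c < a ∧ ∀ i ≤ n, c i = a i := by
  obtain ⟨N, hN⟩ := ha
  let m := N + n + 1
  let c : LL k := toLex (Function.update (ofLex a) m 0)
  have c1 : ∀ i, i ≠ m → c i = a i := fun i hi => Function.update_of_ne hi _ _
  have c2 : c m = 0 := Function.update_self _ _ _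
  have hl : (0 : Fin (k + 2)) < Fin.last (k + 1) := Fin.last_pos
  refine ⟨c, ⟨⟨m + 1, fun i hi => ?_⟩, m, by rw [c2]; exact hl⟩, LL_lt.2 ⟨m, fun i hi => c1 i hi.ne, ?_⟩,
    fun i hi => c1 i (by omega)⟩
  · rw [c1 i (by omega), hN i (by omega)]
  · rw [c2, hN m (by omega)]; exact hl

theorem AA_between {k : ℕ} (x a : LL k) (ha : ∃ N, ∀ n, N ≤ n → a n = Fin.last (k + 1))
    (h : x < a) : ∃ c ∈ AA k, x < c ∧ c < a := by
  obtain ⟨n, h1, h2⟩ := LL_lt.1 h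
  obtain ⟨c, hc, h3, h4⟩ := AA_below a ha n
  exact ⟨c, hc, LL_lt.2 ⟨n, fun m hm => by rw [h4 m hm.le, h1 m hm], by rwa [h4 n le_rfl]⟩, h3⟩

def topp (k : ℕ) : LL k := toLex (fun _ => Fin.last (k + 1))

theorem le_topp {k : ℕ} (x : LL k) : x ≤ topp k := by
  by_contra h
  obtain ⟨n, -, h2⟩ := LL_lt.1 (not_le.1 h)
  exact absurd h2 (not_lt.2 (Fin.le_last _))

theorem AA_countable (k : ℕ) : (AA k).Countable := by
  apply (Set.countable_range (fun l : List (Fin (k + 2)) =>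
    (toLex (fun i => l.getD i (Fin.last (k + 1))) : LL k))).mono
  rintro a ⟨⟨N, hN⟩, -⟩
  refine ⟨List.ofFn (fun i : Fin N => a i), ?_⟩
  funext i
  change List.getD _ i _ = _
  rcases lt_or_ge i N with h | h
  · simp [List.getD, h]
  · simp [List.getD, h, hN i h]

theorem AA_isoQ (k : ℕ) : Nonempty (AA k ≃o ℚ) := by
  have : Countable (AA k) := (AA_countable k).to_subtype
  have : DenselyOrdered (AA k) := ⟨fun x y h => by
    obtain ⟨c, hc, h1, h2⟩ := AA_between x.1 y.1 y.2.1 h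
    exact ⟨⟨c, hc⟩, h1, h2⟩⟩
  have : NoMinOrder (AA k) := ⟨fun x => by
    obtain ⟨c, hc, h1, h2⟩ := AA_below x.1 x.2.1 0
    exact ⟨⟨c, hc⟩, h1⟩⟩
  have : NoMaxOrder (AA k) := ⟨fun x => by
    have : x.1 < topp k := by
      apply lt_of_le_of_ne (le_topp _)
      intro h
      obtain ⟨n, hn⟩ := x.2.2
      rw [h] at hn
      exact lt_irrefl _ hn
    obtain ⟨c, hc, h1, h2⟩ := AA_between x.1 (topp k) ⟨0, fun _ _ => rfl⟩ this
    exact ⟨⟨c, hc⟩, h1⟩⟩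
  have : Nonempty (AA k) := by
    obtain ⟨c, hc, -⟩ := AA_below (topp k) ⟨0, fun _ _ => rfl⟩ 0
    exact ⟨⟨c, hc⟩⟩
  exact Order.iso_of_countable_dense _ _

theorem le_of_agree {k : ℕ} {a y z : LL k} {N : ℕ} (hN : ∀ n, N ≤ n → a n = Fin.last (k + 1))
    (h : ∀ i, i < N → y i = z i) (hy : y ≤ a) : z ≤ a := by
  by_contra hz
  obtain ⟨m, h1, h2⟩ := LL_lt.1 (not_le.1 hz)
  have hm : m < N := by
    by_contra hm
    rw [hN m (by omega)] at h2
    exact absurd h2 (not_lt.2 (Fin.le_last _))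
  exact absurd (LL_lt.2 ⟨m, fun i hi => by rw [h1 i hi, h i (by omega)], by rwa [h m hm]⟩ : a < y)
    (not_lt.2 hy)

theorem ev_agree {k : ℕ} (x : ℕ → Fin (k + 2)) (N : ℕ) :
    ∀ᶠ y in nhds x, ∀ i, i < N → x i = y i := by
  have : ∀ i, ∀ᶠ y in nhds x, x i = y i := by
    intro i
    have h : Filter.Tendsto (fun y : ℕ → Fin (k + 2) => y i) (nhds x) (nhds (x i)) :=
      (continuous_apply i).tendsto x
    rw [nhds_discrete (Fin (k + 2))] at h
    have h2 := Filter.tendsto_pure.1 h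
    filter_upwards [h2] with y hy using hy.symm
  have h2 := (Filter.eventually_all_finite (Set.finite_lt_nat N)).2 (fun i _ => this i)
  exact h2

theorem agree_of {k : ℕ} (n : ℕ) (x y : LL k)
    (h : ∀ l : Fin (n + 1) → Fin (k + 2),
      ∀ a : LL k, a = toLex (fun i => if hi : i < n + 1 then l ⟨i, hi⟩ else Fin.last (k + 1)) →
      a ∈ AA k → (x ≤ a ↔ y ≤ a)) : x n = y n := by
  have aux : ∀ u v : LL k, u < v → (∀ m ≤ n, ∀ w : LL k, cut m w ∈ AA k → (v ≤ cut m w ↔ u ≤ cut m w)) →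
      u n = v n := by
    intro u v huv H
    obtain ⟨m, h1, h2⟩ := LL_lt.1 huv
    rcases lt_or_ge n m with h3 | h3
    · exact h1 n h3
    · have := cut_sep h1 h2
      exact absurd ((H m h3 u this.1).2 (le_cut _ _)) (not_le.2 this.2)
  have H : ∀ m ≤ n, ∀ w : LL k, cut m w ∈ AA k → (x ≤ cut m w ↔ y ≤ cut m w) := by
    intro m hm w hw
    refine h (fun i => cut m w i) _ ?_ hw
    funext i
    change _ = dite _ _ _
    split_ifs with hi
    · rfl
    · exact cut_gt m w i (by omega)
  rcases lt_trichotomy x y with h1 | h1 | h1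
  · exact aux x y h1 (fun m hm w hw => (H m hm w hw).symm)
  · rw [h1]
  · exact (aux y x h1 H).symm

theorem exists_f_with_Yset_eq (b : ℕ) (hb : 2 ≤ b) (Y : Set (ℕ → Fin b))
    (hY : Y ⊆ AbSet b) (hiso : OrderIsoQ b Y) :
    ∃ f, CSur b f ∧ Yset b f = Y := by
  obtain ⟨k, rfl⟩ : ∃ k, b = k + 2 := ⟨b - 2, by omega⟩
  obtain ⟨e, he⟩ := hiso
  obtain ⟨ψ⟩ := AA_isoQ k
  let φ : AA k → LL k := fun a => toLex (e (ψ a)).1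
  have hφm : StrictMono φ := by
    apply Monotone.strictMono_of_injective
    · intro a a' h
      exact (LL_lexLE _ _).1 ((he _ _).1 (ψ.monotone h))
    · intro a a' h
      exact ψ.injective (e.injective (Subtype.ext h))
  have hφA : ∀ a, φ a ∈ AA k := fun a => (mem_AA _).1 (hY (e (ψ a)).2)
  have hφY : ∀ y ∈ Y, ∃ a, φ a = toLex y := fun y hy =>
    ⟨ψ.symm (e.symm ⟨y, hy⟩), by simp [φ]⟩
  obtain ⟨f, fmono, fsurj, fkey, fφ⟩ := absPart LL_glb (AA k) AA_succ AA_sep φ hφm hφA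
  have ftop : f (topp k) = topp k := by
    obtain ⟨x, hx⟩ := fsurj (topp k)
    exact le_antisymm (le_topp _) (hx.symm.le.trans (fmono (le_topp x)))
  -- the maximum of the preimage of W s
  have hWs : ∀ (s : List (Fin (k + 2))) (m : LL k),
      (∀ i, m i = s.getD i (Fin.last (k + 1))) → (ofLex m ∈ W (k + 2) s ∧
        ∀ z : LL k, ofLex z ∈ W (k + 2) s → z ≤ m) := by
    intro s m hm
    refine ⟨fun i hi => ?_, fun z hz => ?_⟩
    · change m i = _
      rw [hm i]; simp [List.getD, hi]
    · by_contra hc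
      obtain ⟨i, -, h2⟩ := LL_lt.1 (not_le.1 hc)
      rw [hm i] at h2
      rcases lt_or_ge i s.length with hi | hi
      · have h3 : z i = _ := hz i hi
        rw [h3] at h2
        simp [List.getD, hi] at h2
      · simp only [List.getD, List.getElem?_eq_none hi] at h2
        exact absurd h2 (not_lt.2 (Fin.le_last _))
  have hmax : ∀ (s : List (Fin (k + 2))) (a : AA k),
      (∀ i, a.1 i = s.getD i (Fin.last (k + 1))) →
        IsGreatestLex (k + 2) ((fun x => ofLex (f (toLex x))) ⁻¹' W (k + 2) s) (ofLex (φ a)) := by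
    intro s a ha
    obtain ⟨h1, h2⟩ := hWs s a.1 ha
    refine ⟨?_, fun y hy => ?_⟩
    · change ofLex (f (φ a)) ∈ W (k + 2) s
      rw [fφ]; exact h1
    · rw [LL_lexLE]
      exact (fkey (toLex y) a).1 (h2 (f (toLex y)) hy)
  have hasymm : ∀ x y : ℕ → Fin (k + 2), lexLE (k + 2) x y → lexLE (k + 2) y x → x = y := by
    intro x y h1 h2
    exact toLex.injective (le_antisymm ((LL_lexLE _ _).1 h1) ((LL_lexLE _ _).1 h2))
  refine ⟨fun x => ofLex (f (toLex x)), ⟨?_, ?_, ?_⟩, ?_⟩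
  · apply continuous_pi
    intro n
    rw [continuous_iff_continuousAt]
    intro x
    unfold ContinuousAt
    rw [nhds_discrete (Fin (k + 2)), Filter.tendsto_pure]
    have : ∀ l : Fin (n + 1) → Fin (k + 2), ∀ᶠ y in nhds x, ∀ a : LL k,
        a = toLex (fun i => if hi : i < n + 1 then l ⟨i, hi⟩ else Fin.last (k + 1)) →
        a ∈ AA k → (f (toLex y) ≤ a ↔ f (toLex x) ≤ a) := by
      intro l
      by_cases hl : (toLex (fun i => if hi : i < n + 1 then l ⟨i, hi⟩ else Fin.last (k + 1)) : LL k)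
          ∈ AA k
      · obtain ⟨N, hN⟩ := (hφA ⟨_, hl⟩).1
        filter_upwards [ev_agree x N] with y hy
        rintro a rfl ha
        rw [fkey _ ⟨_, ha⟩, fkey _ ⟨_, ha⟩]
        exact ⟨le_of_agree hN (fun i hi => (hy i hi).symm), le_of_agree hN hy⟩
      · apply Filter.Eventually.of_forall
        rintro y a rfl ha
        exact absurd ha hl
    filter_upwards [Filter.eventually_all.2 this] with y hy
    exact agree_of n _ _ hy
  · intro z
    obtain ⟨x, hx⟩ := fsurj (toLex z)
    exact ⟨ofLex x, hx⟩
  · intro x y h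
    rw [LL_lexLE] at h ⊢
    exact fmono h
  · ext y
    constructor
    · rintro ⟨⟨s, hs⟩, hy⟩
      let m : LL k := toLex (fun i => s.getD i (Fin.last (k + 1)))
      by_cases hm : m ∈ AA k
      · have h := hmax s ⟨m, hm⟩ (fun i => rfl)
        have : y = ofLex (φ ⟨m, hm⟩) := hasymm _ _ (h.2 y hs.1) (hs.2 _ h.1)
        rw [this]
        exact (e _).2
      · exfalso
        apply hy
        have hmt : m = topp k := by
          by_contra hne
          apply hm
          refine ⟨⟨s.length, fun i hi => ?_⟩, ?_⟩
          · change s.getD i _ = _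
            simp [List.getD, List.getElem?_eq_none hi]
          · by_contra hc
            push Not at hc
            apply hne
            funext i
            exact le_antisymm (Fin.le_last _) (hc i)
        have h1 := (hWs s m (fun i => rfl)).1
        have h2 : lexLE (k + 2) (ofLex (topp k)) y := by
          apply hs.2
          change ofLex (f (topp k)) ∈ W (k + 2) s
          rw [ftop, ← hmt]; exact h1
        have h3 : ofLex (topp k) = y := hasymm _ _ h2 ((LL_lexLE _ _).2 (le_topp _))
        rw [← h3]
        exact fun n j => Fin.le_last j
    · intro hy
      refine ⟨?_, (hY hy).2⟩
      obtain ⟨a, ha⟩ := hφY y hy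
      obtain ⟨N, hN⟩ := a.2.1
      refine ⟨List.ofFn (fun i : Fin N => a.1 i), ?_⟩
      have h := hmax (List.ofFn (fun i : Fin N => a.1 i)) a ?_
      · rw [ha] at h; exact h
      · intro i
        rcases lt_or_ge i N with h | h
        · simp [List.getD, h]
        · simp [List.getD, h, hN i h]
end

section
/- For every integer b ≥ 2 and real ε > 0 there exists a positive integer t (namely t = t_{b^k - 1} with k = ⌊log₂(1/ε)⌋+1, where t_l is the l-th odd tangent number) such that for every finite coloring c : C↑_sur(b^ω) → K there exist h ∈ C↑_sur(b^ω) and a set B of at most t colors such that for every f ∈ C↑_sur(b^ω) there is g ∈ C↑_sur(b^ω) with ρ_∞(g, f∘h) < ε and c(g) ∈ B. -/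
namespace Osc
open Filter

section HJ

@[reducible] def lsg (α : Type*) : Semigroup (List α) where
  mul a b := a ++ b
  mul_assoc := List.append_assoc

attribute [local instance] lsg Ultrafilter.semigroup

theorem lmul {α : Type*} (a b : List α) : a * b = a ++ b := rfl

theorem umap_mul {α β : Type*} (f : α → β) (p q : Ultrafilter (List α)) :
    Ultrafilter.map (List.map f) (p * q) =
      Ultrafilter.map (List.map f) p * Ultrafilter.map (List.map f) q := by
  apply Ultrafilter.coe_inj.mp
  apply Filter.ext'
  intro P
  rw [Ultrafilter.eventually_mul]
  simp only [Ultrafilter.coe_map, Filter.eventually_map]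
  rw [Ultrafilter.eventually_mul]
  simp only [lmul, List.map_append]

theorem min_left_ideal (S : Type*) [Semigroup S] [Nonempty S] :
    ∃ L : Set (Ultrafilter S), L.Nonempty ∧ (∀ p, ∀ q ∈ L, p * q ∈ L) ∧
      ∀ p ∈ L, ∀ q ∈ L, q * q = q → p * q = p := by
  let F : Set (Set (Ultrafilter S)) := {N | IsClosed N ∧ N.Nonempty ∧ ∀ p, ∀ q ∈ N, p * q ∈ N}
  obtain ⟨L, hL⟩ : ∃ L, Minimal (· ∈ F) L := by
    suffices H : ∀ c ⊆ F, IsChain (· ⊆ ·) c → c.Nonempty → ∃ lb ∈ F, ∀ s ∈ c, lb ⊆ s by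
      obtain ⟨L, -, hL⟩ := zorn_superset_nonempty F H Set.univ ⟨isClosed_univ, Set.univ_nonempty, by simp⟩
      exact ⟨L, hL⟩
    · intro c hc hch hne
      refine ⟨⋂₀ c, ⟨isClosed_sInter fun s hs => (hc hs).1, ?_, ?_⟩, fun s hs => Set.sInter_subset_of_mem hs⟩
      · have := hne.to_subtype
        apply IsCompact.nonempty_sInter_of_directed_nonempty_isCompact_isClosed
        · intro x hx y hy
          rcases hch.total hx hy with h | h
          · exact ⟨x, hx, subset_rfl, h⟩
          · exact ⟨y, hy, h, subset_rfl⟩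
        · exact fun s hs => (hc hs).2.1
        · exact fun s hs => (hc hs).1.isCompact
        · exact fun s hs => (hc hs).1
      · intro p q hq s hs
        exact (hc hs).2.2 p q (hq s hs)
  refine ⟨L, hL.prop.2.1, hL.prop.2.2, ?_⟩
  intro p hp q hq hqq
  have h1 : Set.range (fun r => r * q) ∈ F := by
    refine ⟨(isCompact_range (Ultrafilter.continuous_mul_left q)).isClosed, Set.range_nonempty _, ?_⟩
    rintro r _ ⟨s, rfl⟩
    exact ⟨r * s, mul_assoc _ _ _⟩
  have h2 : L ⊆ Set.range (fun r => r * q) := by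
    apply hL.le_of_le h1
    rintro _ ⟨s, rfl⟩
    exact hL.prop.2.2 _ _ hq
  obtain ⟨r, rfl⟩ := h2 hp
  simp only [mul_assoc, hqq]

/-- substitution -/
def sub {A : Type*} (a : A) (w : List (Option A)) : List A := w.map (fun o => o.getD a)

theorem exists_y (A : Type*) : ∃ y : Ultrafilter (List (Option A)),
    (∀ᶠ w in (y : Filter (List (Option A))), ∃ d, w = none :: d) ∧
    ∀ a b : A, Ultrafilter.map (sub a) y * Ultrafilter.map (sub b) y = Ultrafilter.map (sub a) y := by
  obtain ⟨L, ⟨u, hu⟩, hL, hLm⟩ := min_left_ideal (List A)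
  let iu : Ultrafilter (List (Option A)) := Ultrafilter.map (List.map some) u
  let R : Set (Ultrafilter (List (Option A))) :=
    {p | {w | ∃ d, w = none :: d} ∈ p} ∩ Set.range (fun z => z * iu)
  obtain ⟨y, ⟨hy1, z, hz⟩, hyy⟩ : ∃ y ∈ R, y * y = y := by
    apply exists_idempotent_in_compact_subsemigroup Ultrafilter.continuous_mul_left
    · refine ⟨(pure [none] : Ultrafilter (List (Option A))) * iu, ?_, ⟨_, rfl⟩⟩
      change ∀ᶠ w in ((pure [none] * iu : Ultrafilter (List (Option A))) : Filter (List (Option A))), ∃ d, w = none :: d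
      rw [Ultrafilter.eventually_mul]
      rw [Ultrafilter.coe_pure, Filter.eventually_pure]
      exact Filter.Eventually.of_forall fun d => ⟨d, rfl⟩
    · apply IsClosed.isCompact
      apply IsClosed.inter
      · exact ultrafilter_isClosed_basic _
      · exact (isCompact_range (Ultrafilter.continuous_mul_left iu)).isClosed
    · rintro p ⟨hp, -⟩ q ⟨-, z, rfl⟩
      refine ⟨?_, p * z, mul_assoc _ _ _⟩
      change ∀ᶠ w in ((p * (z * iu) : Ultrafilter (List (Option A))) : Filter (List (Option A))), ∃ d, w = none :: d
      rw [Ultrafilter.eventually_mul]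
      change ∀ᶠ w in (p : Filter (List (Option A))), ∃ d, w = none :: d at hp
      filter_upwards [hp] with w hw
      obtain ⟨d, rfl⟩ := hw
      exact Filter.Eventually.of_forall fun d' => ⟨d ++ d', rfl⟩
  refine ⟨y, hy1, ?_⟩
  have hs : ∀ a : A, (sub a : List (Option A) → List A) = List.map (fun o => o.getD a) := fun a => rfl
  have hmem : ∀ a : A, Ultrafilter.map (sub a) y ∈ L := by
    intro a
    rw [← hz, hs, umap_mul]
    apply hL
    have : Ultrafilter.map (List.map fun o : Option A => o.getD a) iu = u := by
      simp only [iu, Ultrafilter.map_map, List.map_comp_map]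
      have : ((fun o : Option A => o.getD a) ∘ some) = id := by ext; simp
      rw [this, List.map_id_fun, Ultrafilter.map_id]
    rw [this]; exact hu
  intro a b
  apply hLm _ (hmem a) _ (hmem b)
  rw [hs, ← umap_mul, hyy]

/-- Build a word from letters. -/
def bld {A : Type*} (d : ℕ → List (Option A)) : ℕ → List A → List A
  | _, [] => []
  | i, a :: r => a :: (sub a (d i) ++ bld d (i+1) r)

theorem bld_snoc {A : Type*} (d : ℕ → List (Option A)) (r : List A) (a : A) (i : ℕ) :
    bld d i (r ++ [a]) = bld d i r ++ (a :: sub a (d (i + r.length))) := by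
  induction r generalizing i with
  | nil => simp [bld]
  | cons x r ih =>
    simp only [List.cons_append, bld, ih, List.length_cons, List.append_assoc]
    have : i + 1 + r.length = i + (r.length + 1) := by omega
    rw [this]

theorem inf_HJ {A κ : Type*} [Finite A] [Nonempty A] [Finite κ] (g : List A → κ) :
    ∃ (c0 : List A) (d : ℕ → List (Option A)) (k : κ), ∀ r, g (c0 ++ bld d 0 r) = k := by
  classical
  obtain ⟨y, hy1, hy2⟩ := exists_y A
  let a0 : A := Classical.arbitrary A
  obtain ⟨k, hk⟩ := Ultrafilter.eq_pure_of_finite (Ultrafilter.map g (Ultrafilter.map (sub a0) y))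
  have hk' : ∀ᶠ s in (Ultrafilter.map (sub a0) y : Filter _), g s = k := by
    have : ∀ᶠ s in (Ultrafilter.map g (Ultrafilter.map (sub a0) y) : Filter _), s = k := by
      rw [hk]; simp
    exact this
  let Good : List A → Prop := fun s => g s = k ∧ ∀ a, ∀ᶠ w in (y : Filter _), g (s ++ sub a w) = k
  have h0 : ∃ s, Good s := by
    have : ∀ᶠ s in (Ultrafilter.map (sub a0) y : Filter _), Good s := by
      refine hk'.and ?_
      rw [Filter.eventually_all]
      intro a
      rw [← hy2 a0 a, Ultrafilter.eventually_mul] at hk'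
      exact hk'
    exact this.exists
  have hstep : ∀ F : Finset (List A), (∀ s ∈ F, Good s) →
      ∃ d : List (Option A), ∀ s ∈ F, ∀ a, Good (s ++ (a :: sub a d)) := by
    intro F hF
    have : ∀ᶠ w in (y : Filter _), ∀ s ∈ F, ∀ a, Good (s ++ sub a w) := by
      rw [Filter.eventually_all_finset]
      intro s hs
      rw [Filter.eventually_all]
      intro a
      refine ((hF s hs).2 a).and ?_
      rw [Filter.eventually_all]
      intro b
      have h3 : ∀ᶠ p in (Ultrafilter.map (sub a) y : Filter _), g (s ++ p) = k := (hF s hs).2 a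
      rw [← hy2 a b, Ultrafilter.eventually_mul] at h3
      have h4 : ∀ᶠ w in (y : Filter _), ∀ᶠ w' in (y : Filter _), g (s ++ (sub a w ++ sub b w')) = k := h3
      simpa only [List.append_assoc] using h4
    obtain ⟨w, hw, d, rfl⟩ := (this.and hy1).exists
    exact ⟨d, hw⟩
  obtain ⟨c0, hc0⟩ := h0
  choose! nxt hnxt using hstep
  let _ := Fintype.ofFinite A
  let nf : Finset (List A) → Finset (List A) := fun F =>
    (F ×ˢ Finset.univ).image (fun z : List A × A => z.1 ++ (z.2 :: sub z.2 (nxt F)))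
  let Fs : ℕ → Finset (List A) := fun j => nf^[j] {c0}
  have hFs : ∀ j, Fs (j+1) = nf (Fs j) := fun j => Function.iterate_succ_apply' _ _ _
  have hg : ∀ j, ∀ s ∈ Fs j, Good s := by
    intro j
    induction j with
    | zero => intro s hs; simp [Fs] at hs; rw [hs]; exact hc0
    | succ j ih =>
      intro s hs
      rw [hFs] at hs
      simp only [nf, Finset.mem_image, Finset.mem_product] at hs
      obtain ⟨⟨s', a⟩, ⟨hs', -⟩, rfl⟩ := hs
      exact hnxt _ ih s' hs' a
  refine ⟨c0, fun j => nxt (Fs j), k, ?_⟩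
  have hmem : ∀ r, c0 ++ bld (fun j => nxt (Fs j)) 0 r ∈ Fs r.length := by
    intro r
    induction r using List.reverseRecOn with
    | nil => simp [bld, Fs]
    | append_singleton r a ih =>
      rw [bld_snoc, ← List.append_assoc, List.length_append, List.length_singleton, hFs]
      simp only [nf, Finset.mem_image, Finset.mem_product]
      refine ⟨(_, a), ⟨ih, Finset.mem_univ _⟩, ?_⟩
      simp
  exact fun r => (hg _ _ (hmem r)).1

end HJ


section Mil

abbrev Nd := List Bool

def SE (e : Nd → Nd) : Prop :=
  (∀ t i, e t ++ [i] <+: e (t ++ [i])) ∧ ∀ t t', t.length = t'.length → (e t).length = (e t').length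

theorem SE.id : SE id := ⟨fun t i => List.prefix_rfl, fun t t' h => h⟩

theorem SE.pre {e : Nd → Nd} (h : SE e) (t r : Nd) : e t <+: e (t ++ r) := by
  induction r using List.reverseRecOn with
  | nil => simp
  | append_singleton r i ih =>
    rw [← List.append_assoc]
    exact (ih.trans (List.prefix_append _ _)).trans (h.1 _ _)

theorem SE.pre' {e : Nd → Nd} (h : SE e) {t t' : Nd} (ht : t <+: t') : e t <+: e t' := by
  obtain ⟨r, rfl⟩ := ht; exact h.pre t r

theorem SE.comp {e f : Nd → Nd} (h : SE e) (h' : SE f) : SE (e ∘ f) :=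
  ⟨fun t i => (h.1 _ _).trans (h.pre' (h'.1 _ _)), fun t t' ht => h.2 _ _ (h'.2 _ _ ht)⟩

/-- lexicographic incomparability order -/
def Llt (t t' : Nd) : Prop := ∃ r, r ++ [false] <+: t ∧ r ++ [true] <+: t'

theorem SE.llt {e : Nd → Nd} (h : SE e) {t t' : Nd} (ht : Llt t t') : Llt (e t) (e t') := by
  obtain ⟨r, h1, h2⟩ := ht
  exact ⟨e r, (h.1 _ _).trans (h.pre' h1), (h.1 _ _).trans (h.pre' h2)⟩

theorem llt_ne {t t' : Nd} (h : Llt t t') : t ≠ t' := by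
  rintro rfl
  obtain ⟨r, h1, h2⟩ := h
  have := List.prefix_of_prefix_length_le h1 h2 (by simp)
  have := this.eq_of_length (by simp)
  simp at this

theorem ne_llt {t t' : Nd} (hl : t.length = t'.length) (h : t ≠ t') : Llt t t' ∨ Llt t' t := by
  induction t generalizing t' with
  | nil => cases t' with
    | nil => exact absurd rfl h
    | cons => simp at hl
  | cons x t ih =>
    cases t' with
    | nil => simp at hl
    | cons y t' =>
      by_cases hxy : x = y
      · subst hxy
        have h' : t ≠ t' := fun hh => h (by rw [hh])
        rcases ih (by simpa using hl) h' with ⟨r, h1, h2⟩ | ⟨r, h1, h2⟩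
        · exact Or.inl ⟨x :: r, by simpa using h1, by simpa using h2⟩
        · exact Or.inr ⟨x :: r, by simpa using h1, by simpa using h2⟩
      · cases x <;> cases y <;> simp at hxy
        · exact Or.inl ⟨[], by simp, by simp⟩
        · exact Or.inr ⟨[], by simp, by simp⟩

theorem SE.inj {e : Nd → Nd} (h : SE e) {t t' : Nd} (hl : t.length = t'.length) (he : e t = e t') : t = t' := by
  by_contra hne
  rcases ne_llt hl hne with h1 | h1
  · exact llt_ne (h.llt h1) he
  · exact llt_ne (h.llt h1) he.symm

def ext {n : ℕ} (s : Nd) (a : List.Vector Bool n → Bool) : Bool :=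
  if h : s.length = n then a ⟨s, h⟩ else false

def bldB {n : ℕ} (d : ℕ → List (Option (List.Vector Bool n → Bool))) (s : Nd) : ℕ → Nd → Nd
  | _, [] => []
  | i, a :: r => a :: ((d i).map (fun o => o.elim a (ext s)) ++ bldB d s (i+1) r)

theorem bldB_snoc {n : ℕ} (d : ℕ → List (Option (List.Vector Bool n → Bool))) (s : Nd) (r : Nd) (a : Bool) (i : ℕ) :
    bldB d s i (r ++ [a]) = bldB d s i r ++ (a :: (d (i + r.length)).map (fun o => o.elim a (ext s))) := by
  induction r generalizing i with
  | nil => simp [bldB]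
  | cons x r ih =>
    simp only [List.cons_append, bldB, ih, List.length_cons, List.append_assoc]
    have : i + 1 + r.length = i + (r.length + 1) := by omega
    rw [this]

theorem bldB_length {n : ℕ} (d : ℕ → List (Option (List.Vector Bool n → Bool))) (s s' : Nd) (r r' : Nd) (i : ℕ)
    (h : r.length = r'.length) :
    (bldB d s i r).length = (bldB d s' i r').length := by
  induction r generalizing i r' with
  | nil => cases r' with
    | nil => rfl
    | cons => simp at h
  | cons x r ih => cases r' with
    | nil => simp at h
    | cons y r' => simp [bldB, ih r' (i+1) (by simpa using h)]

theorem bld_map {n : ℕ} (d : ℕ → List (Option (List.Vector Bool n → Bool))) (s : Nd)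
    (r : List (List.Vector Bool n → Bool)) (i : ℕ) :
    (bld d i r).map (ext s) = bldB d s i (r.map (ext s)) := by
  induction r generalizing i with
  | nil => rfl
  | cons a r ih =>
    simp only [bld, bldB, List.map_cons, List.map_append, ih, sub, List.map_map]
    congr 2
    apply List.map_congr_left
    intro o _
    cases o <;> rfl

theorem HL {κ : Type*} [Finite κ] (n : ℕ) (χ : (Nd → Nd) → κ)
    (hχ : ∀ σ σ' : Nd → Nd, (∀ s, s.length = n → σ s = σ' s) → χ σ = χ σ') :
    ∃ g, SE g ∧ (∀ t : Nd, t.length < n → g t = t) ∧ (∀ t : Nd, n ≤ t.length → t.take n <+: g t) ∧ ∃ k, ∀ σ : Nd → Nd, ∀ L,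
      (∀ s, s.length = n → s <+: σ s ∧ (σ s).length = L) → χ (g ∘ σ) = k := by
  obtain ⟨c0, d, k, hk⟩ := inf_HJ (A := List.Vector Bool n → Bool)
    (fun W => χ (fun s => s ++ W.map (ext s)))
  let g : Nd → Nd := fun t => if t.length < n then t else
    t.take n ++ (c0.map (ext (t.take n)) ++ bldB d (t.take n) 0 (t.drop n))
  have hg1 : ∀ t : Nd, t.length < n → g t = t := fun t ht => by simp [g, ht]
  have hg2 : ∀ t : Nd, n ≤ t.length → g t =
    t.take n ++ (c0.map (ext (t.take n)) ++ bldB d (t.take n) 0 (t.drop n)) := fun t ht => by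
      simp [g, Nat.not_lt.mpr ht]
  refine ⟨g, ⟨?_, ?_⟩, hg1, ?_, k, ?_⟩
  · intro t i
    rcases lt_or_ge t.length n with h | h
    · rw [hg1 t h]
      rcases lt_or_ge (t ++ [i]).length n with h' | h'
      · rw [hg1 _ h']
      · rw [hg2 _ h']
        have : (t ++ [i]).take n = t ++ [i] := by
          apply List.take_of_length_le; simp; omega
        rw [this]; exact List.prefix_append _ _
    · rw [hg2 t h, hg2 (t ++ [i]) (by simp; omega), List.take_append_of_le_length h,
        List.drop_append_of_le_length h, bldB_snoc]
      refine ⟨(d (0 + (t.drop n).length)).map (fun o => o.elim i (ext (t.take n))), ?_⟩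
      simp
  · intro t t' ht
    rcases lt_or_ge t.length n with h | h
    · rw [hg1 t h, hg1 t' (by omega), ht]
    · rw [hg2 t h, hg2 t' (by omega)]
      have := bldB_length d (t.take n) (t'.take n) (t.drop n) (t'.drop n) 0 (by simp [ht])
      simp [this, ht]
  · intro t ht
    rw [hg2 t ht]; exact List.prefix_append _ _
  · intro σ L hσ
    let rw' : List (List.Vector Bool n → Bool) :=
      (List.range (L - n)).map (fun j v => (σ v.1).getD (n + j) false)
    have hr : ∀ s : Nd, s.length = n → rw'.map (ext s) = (σ s).drop n := by
      intro s hs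
      apply List.ext_getElem
      · simp [rw', (hσ s hs).2]
      · intro j h1 h2
        simp only [rw', List.map_map, List.getElem_map, List.getElem_range, Function.comp, ext, hs,
          dite_true, List.getElem_drop]
        rw [List.getD_eq_getElem]
    rw [← hk rw']
    apply hχ
    intro s hs
    obtain ⟨h1, h2⟩ := hσ s hs
    have hle : n ≤ (σ s).length := hs ▸ h1.length_le
    have ht : (σ s).take n = s := by
      obtain ⟨q, hq⟩ := h1
      rw [← hq, ← hs]; simp
    simp only [Function.comp]
    rw [hg2 _ hle, ht, List.map_append, bld_map, hr s hs]

def restr (k : ℕ) (e : Nd → Nd) : Nd → Nd := fun t => if t.length < k then e t else []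

/-- parameter of a subtree at level `n` -/
def Par (k n : ℕ) (e : Nd → Nd) (a β : Nd → Nd) : Prop :=
  (∀ p : Nd, p.length < k → e p = a p ∧ (a p).length < n) ∧
  (∀ p : Nd, p.length = k → β p <+: e p ∧ (β p).length = n) ∧
  (∀ p p' : Nd, p.length = k → p'.length = k → β p = β p' → p = p')

theorem step {κ : Type*} [Finite κ] (k n : ℕ) (c : (Nd → Nd) → κ) (e : Nd → Nd) :
    ∃ g, SE g ∧ (∀ t : Nd, t.length < n → g t = t) ∧ ∀ a β e' e'', SE e' → SE e'' →
      Par k n e' a β → Par k n e'' a β →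
      c (restr (k+1) (e ∘ g ∘ e')) = c (restr (k+1) (e ∘ g ∘ e'')) := by
  classical
  let P := ({p : Nd // p.length < k} → {q : Nd // q.length < n}) ×
    ({p : Nd // p.length = k} → {q : Nd // q.length = n})
  have f1 : Finite {p : Nd // p.length < k} := (List.finite_length_lt Bool k)
  have f2 : Finite {p : Nd // p.length < n} := (List.finite_length_lt Bool n)
  have f3 : Finite {p : Nd // p.length = k} := (List.finite_length_eq Bool k)
  have f4 : Finite {p : Nd // p.length = n} := (List.finite_length_eq Bool n)
  let χ : (Nd → Nd) → (P → κ) := fun σ P =>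
    c (fun p => if h : p.length < k then e (P.1 ⟨p, h⟩) else
      if h : p.length = k then e (σ (P.2 ⟨p, h⟩)) else [])
  obtain ⟨g, hg, hg1, -, q, hq⟩ := HL n χ (by
    intro σ σ' h
    funext P
    simp only [χ]
    congr 1
    funext p
    split_ifs with h1 h2
    · rfl
    · rw [h _ (P.2 ⟨p, h2⟩).2]
    · rfl)
  refine ⟨g, hg, hg1, ?_⟩
  intro a β
  by_cases hP : (∀ p : Nd, p.length < k → (a p).length < n) ∧ (∀ p : Nd, p.length = k → (β p).length = n)
  swap
  · intro e' e'' _ _ h1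
    exact absurd ⟨fun p hp => (h1.1 p hp).2, fun p hp => (h1.2.1 p hp).2⟩ hP
  let PP : P := ⟨fun p => ⟨a p.1, hP.1 _ p.2⟩, fun p => ⟨β p.1, hP.2 _ p.2⟩⟩
  have key : ∀ e', SE e' → Par k n e' a β → c (restr (k+1) (e ∘ g ∘ e')) = q PP := by
    intro e' he' h
    let L := (e' (List.replicate k false)).length
    have hnL : n ≤ L := by
      have := h.2.1 (List.replicate k false) (by simp)
      rw [← this.2]; exact this.1.length_le
    let σ : Nd → Nd := fun s => if hs : ∃ p : Nd, p.length = k ∧ β p = s then e' hs.choose else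
      s ++ List.replicate (L - n) false
    have hσ1 : ∀ p : Nd, p.length = k → σ (β p) = e' p := by
      intro p hp
      have hs : ∃ p' : Nd, p'.length = k ∧ β p' = β p := ⟨p, hp, rfl⟩
      simp only [σ, dif_pos hs]
      rw [h.2.2 _ _ hs.choose_spec.1 hp hs.choose_spec.2]
    have := hq σ L (by
      intro s hs
      by_cases hs' : ∃ p : Nd, p.length = k ∧ β p = s
      · obtain ⟨p, hp, rfl⟩ := hs'
        rw [hσ1 p hp]
        exact ⟨(h.2.1 p hp).1, he'.2 _ _ (by simp [hp])⟩
      · simp only [σ, dif_neg hs']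
        refine ⟨List.prefix_append _ _, ?_⟩
        simp [hs]; omega)
    rw [← this]
    simp only [χ]
    congr 1
    funext p
    simp only [restr, PP, Function.comp]
    rcases lt_trichotomy p.length k with hp | hp | hp
    · rw [if_pos (by omega), dif_pos hp, ← (h.1 p hp).1, hg1]
      rw [(h.1 p hp).1]; exact (h.1 p hp).2
    · rw [if_pos (by omega), dif_neg (by omega), dif_pos hp, hσ1 p hp]
    · rw [if_neg (by omega), dif_neg (by omega), dif_neg (by omega)]
  intro e' e'' he' he'' h' h''
  rw [key e' he' h', key e'' he'' h'']

theorem endhom {κ : Type*} [Finite κ] (k : ℕ) (c : (Nd → Nd) → κ) :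
    ∃ e, SE e ∧ ∀ e' e'', SE e' → SE e'' → restr k e' = restr k e'' →
      c (restr (k+1) (e ∘ e')) = c (restr (k+1) (e ∘ e'')) := by
  choose G hG1 hG2 hG3 using fun n e => step k n c e
  let E : ℕ → (Nd → Nd) := fun n => Nat.rec (fun t => t) (fun n e => e ∘ G n e) n
  have hE0 : E 0 = fun t => t := rfl
  have hE : ∀ n, E (n+1) = E n ∘ G n (E n) := fun n => rfl
  have hSE : ∀ n, SE (E n) := by
    intro n
    induction n with
    | zero => exact SE.id
    | succ n ih => rw [hE]; exact ih.comp (hG1 _ _)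
  have hfac : ∀ n m, n ≤ m → ∃ h, SE h ∧ E m = E n ∘ h ∧ ∀ t : Nd, t.length < n → h t = t := by
    intro n m hm
    induction m, hm using Nat.le_induction with
    | base => exact ⟨fun t => t, SE.id, rfl, fun t _ => rfl⟩
    | succ m hm ih =>
      obtain ⟨h, h1, h2, h3⟩ := ih
      refine ⟨h ∘ G m (E m), h1.comp (hG1 _ _), ?_, ?_⟩
      · rw [hE]; funext t; exact congrFun h2 (G m (E m) t)
      · intro t ht
        simp only [Function.comp]
        rw [hG2 _ _ _ (by omega), h3 _ ht]
  have hst : ∀ n m, ∀ t : Nd, t.length < n → n ≤ m → E m t = E n t := by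
    intro n m t ht hm
    obtain ⟨h, -, h2, h3⟩ := hfac n m hm
    rw [h2, Function.comp, h3 t ht]
  let e : Nd → Nd := fun t => E (t.length + 1) t
  have he : ∀ m, ∀ t : Nd, t.length < m → e t = E m t := by
    intro m t ht
    exact (hst _ _ t (by omega) ht).symm
  refine ⟨e, ⟨?_, ?_⟩, ?_⟩
  · intro t i
    rw [he (t.length + 2) t (by omega), he (t.length + 2) (t ++ [i]) (by simp)]
    exact (hSE (t.length+2)).1 t i
  · intro t t' ht
    rw [he (t.length + 1) t (by omega), he (t.length+1) t' (by omega)]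
    exact (hSE (t.length+1)).2 t t' ht
  · intro e' e'' he' he'' hr
    have hr' : ∀ p : Nd, p.length < k → e' p = e'' p := by
      intro p hp
      have := congrFun hr p
      simpa [restr, hp] using this
    -- common data
    obtain ⟨n, a, β, h1, h2⟩ : ∃ n a β, Par k n e' a β ∧ Par k n e'' a β := by
      cases k with
      | zero =>
        refine ⟨0, fun _ => [], fun _ => [], ⟨?_, ?_, ?_⟩, ⟨?_, ?_, ?_⟩⟩
        · intro p hp; simp at hp
        · intro p hp; simp
        · intro p p' hp hp' _
          rw [List.length_eq_zero_iff.mp hp, List.length_eq_zero_iff.mp hp']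
        · intro p hp; simp at hp
        · intro p hp; simp
        · intro p p' hp hp' _
          rw [List.length_eq_zero_iff.mp hp, List.length_eq_zero_iff.mp hp']
      | succ k =>
        have hlen : ∀ p : Nd, p.length ≤ k → (e' p).length ≤ (e' (List.replicate k false)).length := by
          intro p hp
          have h1 := (he'.pre p (List.replicate (k - p.length) false)).length_le
          have h2 := he'.2 (p ++ List.replicate (k - p.length) false) (List.replicate k false) (by simp; omega)
          omega
        have inj : ∀ p p' : Nd, p.length = k+1 → p'.length = k+1 →
            e' p.dropLast ++ [p.getLastD false] = e' p'.dropLast ++ [p'.getLastD false] → p = p' := by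
          intro p p' hp hp' h
          have h1 := List.append_inj' h rfl
          have h2 := he'.inj (by simp [hp, hp']) h1.1
          have hne : p ≠ [] := by rintro rfl; simp at hp
          have hne' : p' ≠ [] := by rintro rfl; simp at hp'
          rw [← List.dropLast_append_getLast hne, ← List.dropLast_append_getLast hne', h2]
          have h3 := h1.2
          rw [List.getLastD_eq_getLast?, List.getLastD_eq_getLast?, List.getLast?_eq_some_getLast hne,
            List.getLast?_eq_some_getLast hne'] at h3
          simpa using h3
        have pr : ∀ f, SE f → ∀ p : Nd, p.length = k+1 → f p.dropLast ++ [p.getLastD false] <+: f p := by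
          intro f hf p hp
          have hne : p ≠ [] := by rintro rfl; simp at hp
          conv_rhs => rw [← List.dropLast_append_getLast hne]
          rw [List.getLastD_eq_getLast?, List.getLast?_eq_some_getLast hne]
          exact hf.1 _ _
        refine ⟨(e' (List.replicate k false)).length + 1, e',
          fun p => e' p.dropLast ++ [p.getLastD false], ⟨?_, ?_, inj⟩, ⟨?_, ?_, inj⟩⟩
        · intro p hp
          exact ⟨rfl, by have := hlen p (by omega); omega⟩
        · intro p hp
          refine ⟨pr e' he' p hp, ?_⟩
          simp only [List.length_append, List.length_singleton]
          rw [he'.2 _ (List.replicate k false) (by simp [hp])]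
        · intro p hp
          exact ⟨(hr' p hp).symm, by have := hlen p (by omega); omega⟩
        · intro p hp
          refine ⟨?_, ?_⟩
          · show e' p.dropLast ++ [p.getLastD false] <+: e'' p
            rw [hr' p.dropLast (by simp [hp])]
            exact pr e'' he'' p hp
          · simp only [List.length_append, List.length_singleton]
            rw [he'.2 _ (List.replicate k false) (by simp [hp])]
    have bd : ∀ f, SE f → ∀ p : Nd, p.length < k + 1 → (f p).length ≤ (f (List.replicate k false)).length := by
      intro f hf p hp
      have h1 := (hf.pre p (List.replicate (k - p.length) false)).length_le
      have h2 := hf.2 (p ++ List.replicate (k - p.length) false) (List.replicate k false) (by simp; omega)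
      omega
    obtain ⟨M, hM1, hM2, hM3⟩ : ∃ M, n + 1 ≤ M ∧ (∀ p : Nd, p.length < k+1 → (e' p).length < M) ∧
        (∀ p : Nd, p.length < k+1 → (e'' p).length < M) := by
      refine ⟨n + 1 + ((e' (List.replicate k false)).length + 1) + ((e'' (List.replicate k false)).length + 1),
        by omega, ?_, ?_⟩
      · intro p hp; have := bd e' he' p hp; omega
      · intro p hp; have := bd e'' he'' p hp; omega
    obtain ⟨h, hh1, hh2, hh3⟩ := hfac (n+1) M hM1
    have conv : ∀ f, (∀ p : Nd, p.length < k+1 → (f p).length < M) →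
        restr (k+1) (e ∘ f) = restr (k+1) (E n ∘ G n (E n) ∘ (h ∘ f)) := by
      intro f hf
      funext p
      simp only [restr]
      split_ifs with hp
      · simp only [Function.comp]
        rw [he M _ (hf p hp), hh2, hE]; rfl
      · rfl
    have par : ∀ f, SE f → Par k n f a β → Par k n (h ∘ f) a β := by
      intro f hf hp
      refine ⟨?_, ?_, hp.2.2⟩
      · intro p hpk
        have := hp.1 p hpk
        refine ⟨?_, this.2⟩
        simp only [Function.comp]
        rw [this.1, hh3]; omega
      · intro p hpk
        have := hp.2.1 p hpk
        refine ⟨?_, this.2⟩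
        have h4 := hh1.pre' this.1
        rwa [hh3 (β p) (by omega)] at h4
    rw [conv e' hM2, conv e'' hM3]
    exact hG3 n (E n) a β _ _ (hh1.comp he') (hh1.comp he'') (par e' he' h1) (par e'' he'' h2)

theorem milliken {κ : Type*} [Finite κ] (k : ℕ) (c : (Nd → Nd) → κ) :
    ∃ e, SE e ∧ ∃ q, ∀ e', SE e' → c (restr k (e ∘ e')) = q := by
  classical
  induction k generalizing c with
  | zero =>
    refine ⟨id, SE.id, c (fun _ => []), ?_⟩
    intro e' _
    congr 1
  | succ k ih =>
    obtain ⟨e, he, h⟩ := endhom k c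
    let c' : (Nd → Nd) → κ := fun f => if hf : ∃ e', SE e' ∧ restr k e' = f then
      c (restr (k+1) (e ∘ hf.choose)) else c id
    obtain ⟨e1, he1, q, hq⟩ := ih c'
    refine ⟨e ∘ e1, he.comp he1, q, ?_⟩
    intro e' he'
    rw [← hq e' he']
    have hf : ∃ e'', SE e'' ∧ restr k e'' = restr k (e1 ∘ e') := ⟨_, he1.comp he', rfl⟩
    simp only [c', dif_pos hf]
    rw [Function.comp_assoc]
    exact h _ _ (he1.comp he') hf.choose_spec.1 hf.choose_spec.2.symm

end Mil

section Devlin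

structure DD (β : ℚ → ℕ → Bool) (len : ℚ → ℕ) (mt : ℚ → ℚ → ℕ) : Prop where
  lt1 : ∀ q q', q < q' → mt q q' < len q
  lt2 : ∀ q q', q < q' → mt q q' < len q'
  ag : ∀ q q', q < q' → ∀ m < mt q q', β q m = β q' m
  bf : ∀ q q', q < q' → β q (mt q q') = false
  bt : ∀ q q', q < q' → β q' (mt q q') = true
  d2 : ∀ q q' z, q < q' → mt q q' < len z → β z (mt q q') = true → ∀ m < mt q q', β z m = β q m
  d3 : ∀ q z, len q < len z → β z (len q) = false
  d4 : ∀ q q', len q = len q' → q = q'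
  d5 : ∀ q q' z, q < q' → mt q q' ≠ len z

theorem exists_DD : ∃ β len mt, DD β len mt := by
  classical
  obtain ⟨enc, henc⟩ := exists_injective_nat ℚ
  let sg : ℕ → ℚ → ℚ → Prop := fun j q p => ∀ r, enc r < j → (r < q ↔ r < p)
  let bA : ℚ → ℕ → Prop := fun q j => ∃ p, enc p = j ∧ sg j q p ∧ p ≤ q
  let bB : ℚ → ℕ → Prop := fun q j => ∃ p, enc p = j ∧ sg j q p ∧ p < q
  let β : ℚ → ℕ → Bool := fun q n => if n % 3 = 0 then decide (bA q (n/3)) else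
    if n % 3 = 1 then decide (bB q (n/3)) else false
  have hβ0 : ∀ q j, β q (3*j) = decide (bA q j) := by
    intro q j
    have h1 : 3 * j % 3 = 0 := by omega
    have h2 : 3 * j / 3 = j := by omega
    simp only [β, h1, h2, if_true]
  have hβ1 : ∀ q j, β q (3*j+1) = decide (bB q j) := by
    intro q j
    have h1 : (3 * j+1) % 3 = 1 := by omega
    have h2 : (3 * j+1) / 3 = j := by omega
    simp only [β, h1, h2, if_true]
    simp
  have hβ2 : ∀ q j, β q (3*j+2) = false := by
    intro q j
    have h1 : (3 * j+2) % 3 = 2 := by omega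
    simp only [β, h1]
    simp
  have eA : ∀ p q, (bA q (enc p) ↔ sg (enc p) q p ∧ p ≤ q) := by
    intro p q
    constructor
    · rintro ⟨p', h1, h2⟩
      cases henc h1; exact h2
    · intro h; exact ⟨p, rfl, h⟩
  have eB : ∀ p q, (bB q (enc p) ↔ sg (enc p) q p ∧ p < q) := by
    intro p q
    constructor
    · rintro ⟨p', h1, h2⟩
      cases henc h1; exact h2
    · intro h; exact ⟨p, rfl, h⟩
  -- if q, z have the same cut on codes < j, and codes ≥ j, then bits agree below 3j
  have agr : ∀ j q z, j ≤ enc q → j ≤ enc z → (∀ r, enc r < j → (r < q ↔ r < z)) → ∀ m < 3*j, β q m = β z m := by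
    intro j q z hq hz h m hm
    have hsg : ∀ p, enc p < j → (sg (enc p) q p ↔ sg (enc p) z p) := by
      intro p hp
      constructor
      · intro hh r hr; rw [← h r (by omega)]; exact hh r hr
      · intro hh r hr; rw [h r (by omega)]; exact hh r hr
    have hne : ∀ p, enc p < j → p ≠ q ∧ p ≠ z := by
      intro p hp
      exact ⟨by rintro rfl; omega, by rintro rfl; omega⟩
    obtain ⟨i, hi⟩ : ∃ i, m = 3*i ∨ m = 3*i+1 ∨ m = 3*i+2 := ⟨m/3, by omega⟩
    have hA : bA q i ↔ bA z i := by
      constructor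
      · rintro ⟨p, rfl, h1, h2⟩
        have hp : enc p < j := by omega
        refine ⟨p, rfl, (hsg p hp).1 h1, ?_⟩
        exact ((h p hp).1 (lt_of_le_of_ne h2 (hne p hp).1)).le
      · rintro ⟨p, rfl, h1, h2⟩
        have hp : enc p < j := by omega
        refine ⟨p, rfl, (hsg p hp).2 h1, ?_⟩
        exact ((h p hp).2 (lt_of_le_of_ne h2 (hne p hp).2)).le
    have hB : bB q i ↔ bB z i := by
      constructor
      · rintro ⟨p, rfl, h1, h2⟩
        have hp : enc p < j := by omega
        exact ⟨p, rfl, (hsg p hp).1 h1, (h p hp).1 h2⟩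
      · rintro ⟨p, rfl, h1, h2⟩
        have hp : enc p < j := by omega
        exact ⟨p, rfl, (hsg p hp).2 h1, (h p hp).2 h2⟩
    rcases hi with rfl | rfl | rfl
    · rw [hβ0, hβ0]; simp [hA]
    · rw [hβ1, hβ1]; simp [hB]
    · rw [hβ2, hβ2]
  have hex : ∀ q q' : ℚ, ∃ r, q < q' → (q ≤ r ∧ r ≤ q' ∧ ∀ r', q ≤ r' → r' ≤ q' → enc r ≤ enc r') := by
    intro q q'
    by_cases h : q < q'
    · obtain ⟨r, hr⟩ := exists_minimalFor_of_wellFoundedLT (fun r => q ≤ r ∧ r ≤ q') enc ⟨q, le_refl _, h.le⟩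
      refine ⟨r, fun _ => ⟨hr.1.1, hr.1.2, fun r' h1 h2 => ?_⟩⟩
      by_contra hh
      exact hh (hr.2 ⟨h1, h2⟩ (by omega))
    · exact ⟨q, fun hh => absurd hh h⟩
  choose R hR using hex
  let mt : ℚ → ℚ → ℕ := fun q q' => if q < R q q' then 3 * enc (R q q') else 3 * enc (R q q') + 1
  refine ⟨β, fun q => 3 * enc q + 2, mt, ?_⟩
  have mtc : ∀ q q', q < q' → ∃ r, (q ≤ r ∧ r ≤ q' ∧ ∀ r', q ≤ r' → r' ≤ q' → enc r ≤ enc r') ∧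
      ((q < r ∧ mt q q' = 3 * enc r) ∨ (q = r ∧ mt q q' = 3 * enc r + 1)) := by
    intro q q' h
    refine ⟨R q q', hR q q' h, ?_⟩
    by_cases h' : q < R q q'
    · left; exact ⟨h', by simp [mt, h']⟩
    · right; exact ⟨le_antisymm (hR q q' h).1 (not_lt.mp h'), by simp [mt, h']⟩
  have cut : ∀ q q' r, q < q' → (q ≤ r ∧ r ≤ q' ∧ ∀ r', q ≤ r' → r' ≤ q' → enc r ≤ enc r') →
      ∀ p, enc p < enc r → (p < q ↔ p < r) ∧ (p < q' ↔ p < r) := by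
    intro q q' r hq h p hp
    have : p < q ∨ q' < p := by
      by_contra hh
      push Not at hh
      have := h.2.2 p hh.1 hh.2
      omega
    rcases this with h1 | h1
    · exact ⟨⟨fun _ => h1.trans_le h.1, fun _ => h1⟩, ⟨fun _ => h1.trans_le h.1, fun _ => h1.trans hq⟩⟩
    · have h2 : ¬ p < q := not_lt.mpr (hq.le.trans h1.le)
      have h3 : ¬ p < q' := not_lt.mpr h1.le
      have h4 : ¬ p < r := not_lt.mpr (h.2.1.trans h1.le)
      simp [h2, h3, h4]
  have main : ∀ q q', q < q' → mt q q' < 3 * enc q + 2 ∧ mt q q' < 3 * enc q' + 2 ∧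
      (∀ m < mt q q', β q m = β q' m) ∧ β q (mt q q') = false ∧ β q' (mt q q') = true := by
    intro q q' h
    obtain ⟨r, h1, h2⟩ := mtc q q' h
    have c1 := h1.2.2 q le_rfl h.le
    have c2 := h1.2.2 q' h.le le_rfl
    have c3 := cut q q' r h h1
    have a0 := agr (enc r) q q' c1 c2 (fun p hp => (c3 p hp).1.trans (c3 p hp).2.symm)
    have s1 : sg (enc r) q r := fun p hp => (c3 p hp).1
    have s2 : sg (enc r) q' r := fun p hp => (c3 p hp).2
    rcases h2 with ⟨h3, h4⟩ | ⟨h3, h4⟩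
    · rw [h4]
      refine ⟨by omega, by omega, a0, ?_, ?_⟩
      · rw [hβ0]; simp [eA, h3]
      · rw [hβ0]; simp [eA, s2, h1.2.1]
    · rw [h4]
      refine ⟨by omega, by omega, ?_, ?_, ?_⟩
      · intro m hm
        rcases Nat.lt_succ_iff_lt_or_eq.mp hm with hm | rfl
        · exact a0 m hm
        · rw [hβ0, hβ0]; simp [eA, s1, s2, h1.2.1, h3]; exact fun _ _ => Iff.rfl
      · rw [hβ1]; simp [eB, h3]
      · rw [hβ1]; simp [eB, s2, ← h3, h]
        rw [h3]; exact s2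
  refine ⟨fun q q' h => (main q q' h).1, fun q q' h => (main q q' h).2.1, fun q q' h => (main q q' h).2.2.1,
    fun q q' h => (main q q' h).2.2.2.1, fun q q' h => (main q q' h).2.2.2.2, ?_, ?_, ?_, ?_⟩
  · intro q q' z h hz hb
    obtain ⟨r, h1, h2⟩ := mtc q q' h
    have c1 := h1.2.2 q le_rfl h.le
    have c3 := cut q q' r h h1
    have s1 : sg (enc r) q r := fun p hp => (c3 p hp).1
    rcases h2 with ⟨h3, h4⟩ | ⟨h3, h4⟩
    · rw [h4] at hb hz ⊢
      rw [hβ0] at hb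
      have hb := (eA r z).1 (of_decide_eq_true hb)
      exact agr (enc r) z q (by omega) c1 (fun p hp => (hb.1 p hp).trans (c3 p hp).1.symm)
    · rw [h4] at hb hz ⊢
      rw [hβ1] at hb
      have hb := (eB r z).1 (of_decide_eq_true hb)
      intro m hm
      rcases Nat.lt_succ_iff_lt_or_eq.mp hm with hm | rfl
      · exact agr (enc r) z q (by omega) c1 (fun p hp => (hb.1 p hp).trans (c3 p hp).1.symm) m hm
      · rw [hβ0, hβ0]; simp [eA, s1, hb.1, hb.2.le, h3]; exact fun _ _ => Iff.rfl
  · intro q z _; exact hβ2 _ _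
  · intro q q' h
    exact henc (by simpa using h)
  · intro q q' z h
    obtain ⟨r, h1, h2⟩ := mtc q q' h
    rcases h2 with ⟨h3, h4⟩ | ⟨h3, h4⟩ <;> simp only [h4] <;> omega


theorem sort_uniq {α : Type*} [LinearOrder α] (s : Finset α) (l : List α) (h : l.Pairwise (· < ·))
    (hm : ∀ a, a ∈ l ↔ a ∈ s) : s.sort = l := by
  have h1 : l.toFinset = s := by ext a; simp [hm]
  rw [← h1]
  exact (List.toFinset_sort (· ≤ ·) (h.imp (fun h => ne_of_lt h))).2 (h.imp le_of_lt)

theorem sort_pw {α : Type*} [LinearOrder α] (s : Finset α) : s.sort.Pairwise (· < ·) :=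
  (Finset.sortedLT_sort s).pairwise

def rd (β : ℚ → ℕ → Bool) (len : ℚ → ℕ) (q : ℚ) : List ℕ → List Bool
  | [] => []
  | n :: L => if n < len q then β q n :: rd β len q L else []

def Lev (len : ℚ → ℕ) (mt : ℚ → ℚ → ℕ) (X : Finset ℚ) : Finset ℕ :=
  X.image len ∪ ((X ×ˢ X).filter (fun p => p.1 < p.2)).image (fun p => mt p.1 p.2)

theorem mem_Lev {len mt X n} : n ∈ Lev len mt X ↔ (∃ x ∈ X, len x = n) ∨ ∃ x ∈ X, ∃ y ∈ X, x < y ∧ mt x y = n := by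
  simp only [Lev, Finset.mem_union, Finset.mem_image, Finset.mem_filter, Finset.mem_product, Prod.exists]
  constructor
  · rintro (h | ⟨x, y, ⟨⟨h1, h2⟩, h3⟩, h4⟩)
    · exact Or.inl h
    · exact Or.inr ⟨x, h1, y, h2, h3, h4⟩
  · rintro (h | ⟨x, h1, y, h2, h3, h4⟩)
    · exact Or.inl h
    · exact Or.inr ⟨x, y, ⟨⟨h1, h2⟩, h3⟩, h4⟩

def ty (β : ℚ → ℕ → Bool) (len : ℚ → ℕ) (mt : ℚ → ℚ → ℕ) (X : Finset ℚ) : List (List Bool) :=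
  X.sort.map (fun q => rd β len q (Lev len mt X).sort)

def spread : List Bool → List Bool → List Bool
  | [], _ => []
  | true :: _, [] => []
  | true :: S, x :: w => x :: spread S w
  | false :: S, w => false :: spread S w

def combine (mask : List Bool) (a b : List (List Bool)) : List (List Bool) :=
  a.map (fun w => false :: spread mask w) ++ b.map (fun w => true :: spread (mask.map not) w)

theorem rd_spread (β : ℚ → ℕ → Bool) (len : ℚ → ℕ) (q : ℚ) (P : ℕ → Bool) (L : List ℕ) (hL : L.Pairwise (· < ·))
    (hm : len q ∈ L) (hp : P (len q) = true) (hf : ∀ n ∈ L, P n = false → n < len q → β q n = false) :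
    rd β len q L = spread (L.map P) (rd β len q (L.filter P)) := by
  induction L with
  | nil => simp at hm
  | cons n L ih =>
    rw [List.pairwise_cons] at hL
    rcases lt_trichotomy n (len q) with h | h | h
    · have hm' : len q ∈ L := by
        rcases List.mem_cons.mp hm with h1 | h1
        · omega
        · exact h1
      have ih' := ih hL.2 hm' (fun m hm => hf m (List.mem_cons_of_mem _ hm))
      rcases hP : P n with _ | _
      · simp [rd, h, hP, spread, hf n (by simp) hP h, ih']
      · simp [rd, h, hP, spread, ih']
    · subst h
      simp [rd, hp, spread]
    · exfalso
      rcases List.mem_cons.mp hm with h1 | h1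
      · omega
      · have := hL.1 _ h1; omega

def masks : ℕ → ℕ → Finset (List Bool)
  | 0, 0 => {[]}
  | 0, _ + 1 => ∅
  | n + 1, 0 => (masks n 0).image (List.cons false)
  | n + 1, j + 1 => (masks n j).image (List.cons true) ∪ (masks n (j+1)).image (List.cons false)

theorem masks_card (n j : ℕ) : (masks n j).card ≤ n.choose j := by
  induction n generalizing j with
  | zero => cases j <;> simp [masks]
  | succ n ih =>
    cases j with
    | zero => simpa [masks] using Finset.card_image_le.trans (ih 0)
    | succ j =>
      rw [masks, Nat.choose_succ_succ]
      exact (Finset.card_union_le _ _).trans (add_le_add (Finset.card_image_le.trans (ih _)) (Finset.card_image_le.trans (ih _)))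

theorem mem_masks (l : List Bool) (n j : ℕ) (h1 : l.length = n) (h2 : l.count true = j) : l ∈ masks n j := by
  induction l generalizing n j with
  | nil => simp at h1 h2; subst h1; subst h2; simp [masks]
  | cons x l ih =>
    subst h1
    cases x with
    | false =>
      have h3 : l.count true = j := by simpa using h2
      have := ih l.length j rfl h3
      cases j <;> simp [masks, this]
    | true =>
      have h3 : l.count true + 1 = j := by simpa using h2
      subst h3
      have := ih l.length _ rfl rfl
      simp [masks, this]

def dn : ℕ → ℕ
  | 0 => 0
  | n + 1 => (if n = 0 then 1 else 0) + ∑ j : Fin (n+1), n.choose j * dn j * dn (n - j)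
termination_by n => n
decreasing_by all_goals omega

theorem dn_zero : dn 0 = 0 := by rw [dn]

theorem dn_succ (n : ℕ) : dn (n+1) = (if n = 0 then 1 else 0) + ∑ j ∈ Finset.range (n+1), n.choose j * dn j * dn (n - j) := by
  rw [dn, Finset.sum_range]

theorem dn_sub (n : ℕ) : ∑ i ∈ Finset.range (n+1), (2*n+2).choose (2*i+1) * dn (2*i+1) * dn (2*(n-i)+1) ≤ dn (2*n+3) := by
  rw [dn_succ (2*n+2), if_neg (by omega), zero_add]
  have : ∑ i ∈ Finset.range (n+1), (2*n+2).choose (2*i+1) * dn (2*i+1) * dn (2*(n-i)+1)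
    = ∑ j ∈ (Finset.range (n+1)).image (fun i => 2*i+1), (2*n+2).choose j * dn j * dn (2*n+2-j) := by
    rw [Finset.sum_image (by intro a _ b _ h; simp at h; exact h)]
    apply Finset.sum_congr rfl
    intro i hi
    have : i < n + 1 := Finset.mem_range.mp hi
    congr 2; omega
  rw [this]
  apply Finset.sum_le_sum_of_subset
  intro j hj
  simp only [Finset.mem_image, Finset.mem_range] at hj ⊢
  omega

variable {β : ℚ → ℕ → Bool} {len : ℚ → ℕ} {mt : ℚ → ℚ → ℕ}

theorem DD.ultra (H : DD β len mt) {x y z : ℚ} (h1 : x < y) (h2 : y < z) :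
    mt x z ≤ mt x y ∧ mt x z ≤ mt y z := by
  have h3 := h1.trans h2
  have a1 := H.ag x y h1; have a2 := H.ag y z h2; have a3 := H.ag x z h3
  have f1 := H.bf x y h1; have f2 := H.bf y z h2; have f3 := H.bf x z h3
  have t1 := H.bt x y h1; have t2 := H.bt y z h2; have t3 := H.bt x z h3
  generalize mt x y = p at *
  generalize mt y z = q at *
  generalize mt x z = r at *
  constructor
  · by_contra hc
    push Not at hc
    have e := a3 p hc
    rcases lt_trichotomy q p with h | h | h
    · have := a1 q h; have := a3 q (by omega); simp_all
    · subst h; simp_all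
    · have := a2 p h; simp_all
  · by_contra hc
    push Not at hc
    have e := a3 q hc
    rcases lt_trichotomy p q with h | h | h
    · have := a2 p h; have := a3 p (by omega); simp_all
    · subst h; simp_all
    · have := a1 q h; simp_all

theorem DD.split (H : DD β len mt) (X : Finset ℚ) (hX : 2 ≤ X.card) :
    ∃ n0 X0 X1, X0.Nonempty ∧ X1.Nonempty ∧ X = X0 ∪ X1 ∧ (∀ x ∈ X0, ∀ y ∈ X1, x < y ∧ mt x y = n0) ∧
      (∀ x ∈ X0, β x n0 = false) ∧ (∀ x ∈ X1, β x n0 = true) ∧ (∀ x ∈ X, n0 < len x) ∧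
      (∀ x ∈ X0, ∀ y ∈ X0, x < y → n0 < mt x y) ∧ (∀ x ∈ X1, ∀ y ∈ X1, x < y → n0 < mt x y) := by
  have hne : X.Nonempty := Finset.card_pos.mp (by omega)
  have hlt : X.min' hne < X.max' hne := Finset.min'_lt_max'_of_card X (by omega)
  set a := X.min' hne with ha
  set b := X.max' hne with hb
  have haX : a ∈ X := X.min'_mem hne
  have hbX : b ∈ X := X.max'_mem hne
  have hle : ∀ x ∈ X, a ≤ x ∧ x ≤ b := fun x hx => ⟨X.min'_le x hx, X.le_max' x hx⟩
  have ge : ∀ x ∈ X, ∀ y ∈ X, x < y → mt a b ≤ mt x y := by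
    intro x hx y hy hxy
    have h1 : mt a b ≤ mt a y := by
      rcases (hle y hy).2.lt_or_eq with h | h
      · exact (H.ultra ((hle x hx).1.trans_lt hxy) h).1
      · rw [h]
    rcases (hle x hx).1.lt_or_eq with h | h
    · exact h1.trans (H.ultra h hxy).2
    · rw [← h]; exact h1
  refine ⟨mt a b, X.filter (fun x => β x (mt a b) = false), X.filter (fun x => β x (mt a b) = true), ?_, ?_, ?_, ?_, ?_, ?_, ?_, ?_, ?_⟩
  · exact ⟨a, by simp [haX, H.bf a b hlt]⟩
  · exact ⟨b, by simp [hbX, H.bt a b hlt]⟩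
  · ext x
    simp only [Finset.mem_union, Finset.mem_filter]
    cases β x (mt a b) <;> simp
  · intro x hx y hy
    rw [Finset.mem_filter] at hx hy
    have hxy : x < y := by
      by_contra hc
      rcases (not_lt.mp hc).lt_or_eq with h | h
      · have := ge y hy.1 x hx.1 h
        rcases this.lt_or_eq with h' | h'
        · have := H.ag y x h _ h'; simp_all
        · have := H.bf y x h; rw [← h'] at this; simp_all
      · subst h; simp_all
    refine ⟨hxy, ?_⟩
    rcases (ge x hx.1 y hy.1 hxy).lt_or_eq with h' | h'
    · have := H.ag x y hxy _ h'; simp_all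
    · exact h'.symm
  · intro x hx; exact (Finset.mem_filter.mp hx).2
  · intro x hx; exact (Finset.mem_filter.mp hx).2
  · intro x hx
    rcases (hle x hx).1.lt_or_eq with h | h
    · exact (ge a haX x hx h).trans_lt (H.lt2 a x h)
    · rw [← h]; exact H.lt1 a b hlt
  · intro x hx y hy hxy
    rw [Finset.mem_filter] at hx hy
    refine lt_of_le_of_ne (ge x hx.1 y hy.1 hxy) ?_
    intro h
    have := H.bt x y hxy
    rw [← h] at this; simp_all
  · intro x hx y hy hxy
    rw [Finset.mem_filter] at hx hy
    refine lt_of_le_of_ne (ge x hx.1 y hy.1 hxy) ?_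
    intro h
    have := H.bf x y hxy
    rw [← h] at this; simp_all

/-- levels of the other side carry bit `false`. -/
theorem DD.other (H : DD β len mt) {Y : Finset ℚ} {n0 : ℕ} {z : ℚ} (hs : ∀ y ∈ Y, β z n0 ≠ β y n0)
    (hm : ∀ x ∈ Y, ∀ y ∈ Y, x < y → n0 < mt x y) {n : ℕ} (hn : n ∈ Lev len mt Y) (hz : n < len z) : β z n = false := by
  rcases mem_Lev.mp hn with ⟨x, hx, rfl⟩ | ⟨x, hx, y, hy, hxy, rfl⟩
  · exact H.d3 _ _ hz
  · by_contra hc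
    exact hs x hx (H.d2 x y z hxy hz (by simpa using hc) n0 (hm x hx y hy hxy))

theorem DD.disj (H : DD β len mt) {X Y : Finset ℚ} {n0 : ℕ} (hs : ∀ x ∈ X, ∀ y ∈ Y, β x n0 ≠ β y n0)
    (hm : ∀ x ∈ X, ∀ y ∈ X, x < y → n0 < mt x y) : Disjoint (Lev len mt X) (Lev len mt Y) := by
  rw [Finset.disjoint_left]
  intro n h1 h2
  rcases mem_Lev.mp h1 with ⟨x, hx, rfl⟩ | ⟨x, hx, x', hx', hxx, rfl⟩
  · rcases mem_Lev.mp h2 with ⟨y, hy, h⟩ | ⟨y, hy, y', hy', hyy, h⟩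
    · exact hs x hx y hy (by rw [H.d4 _ _ h])
    · exact H.d5 _ _ _ hyy h
  · rcases mem_Lev.mp h2 with ⟨y, hy, h⟩ | ⟨y, hy, y', hy', hyy, h⟩
    · exact H.d5 _ _ _ hxx h.symm
    · have h3 := H.bt y y' hyy
      have h4 := H.lt2 y y' hyy
      rw [h] at h3 h4
      exact hs x hx y' hy' (H.d2 x x' y' hxx h4 h3 n0 (hm x hx x' hx' hxx)).symm

theorem count_map_filter (L : List ℕ) (P : ℕ → Bool) : (L.map P).count true = (L.filter P).length := by
  induction L with
  | nil => simp
  | cons a L ih => cases h : P a <;> simp [h, ih]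

theorem DD.types (H : DD β len mt) (n : ℕ) : ∃ T : Finset (List (List Bool)), T.card ≤ dn (2*n+1) ∧
    ∀ X : Finset ℚ, X.card = n + 1 → ty β len mt X ∈ T ∧ (Lev len mt X).card = 2*n+1 := by
  classical
  induction n using Nat.strong_induction_on with
  | _ n ih =>
    cases n with
    | zero =>
      refine ⟨{[[]]}, by simp [dn_succ, dn_zero], ?_⟩
      intro X hX
      obtain ⟨x, rfl⟩ := Finset.card_eq_one.mp hX
      have : Lev len mt {x} = {len x} := by
        ext m
        rw [mem_Lev]
        simp
        exact eq_comm
      simp [ty, this, rd]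
    | succ n =>
      choose! T hT1 hT2 using ih
      refine ⟨(Finset.range (n+1)).biUnion (fun i => (masks (2*n+2) (2*i+1) ×ˢ T i ×ˢ T (n-i)).image
        (fun p => combine p.1 p.2.1 p.2.2)), ?_, ?_⟩
      · refine Finset.card_biUnion_le.trans (le_trans ?_ (dn_sub n))
        apply Finset.sum_le_sum
        intro i hi
        have hi' : i < n + 1 := Finset.mem_range.mp hi
        refine Finset.card_image_le.trans ?_
        rw [Finset.card_product, Finset.card_product, mul_assoc]
        exact Nat.mul_le_mul (masks_card _ _) (Nat.mul_le_mul (hT1 i hi') (hT1 (n-i) (by omega)))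
      · intro X hX
        obtain ⟨n0, X0, X1, ne0, ne1, rfl, hc, hf, ht, hl, h0, h1⟩ := H.split X (by omega)
        have hd : Disjoint X0 X1 := by
          rw [Finset.disjoint_left]; intro x hx hy; exact absurd (hc x hx x hy).1 (lt_irrefl _)
        rw [Finset.card_union_of_disjoint hd] at hX
        have p0 := ne0.card_pos
        have p1 := ne1.card_pos
        obtain ⟨i, hi⟩ : ∃ i, X0.card = i + 1 := ⟨X0.card - 1, by omega⟩
        have hi1 : X1.card = (n - i) + 1 := by omega
        have r0 := hT2 i (by omega) X0 hi
        have r1 := hT2 (n-i) (by omega) X1 hi1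
        have hs : ∀ x ∈ X0, ∀ y ∈ X1, β x n0 ≠ β y n0 := by
          intro x hx y hy; rw [hf x hx, ht y hy]; simp
        have hdL := H.disj hs h0
        have big : ∀ m ∈ Lev len mt X0 ∪ Lev len mt X1, n0 < m := by
          intro m hm
          rcases Finset.mem_union.mp hm with hm | hm
          · rcases mem_Lev.mp hm with ⟨x, hx, rfl⟩ | ⟨x, hx, y, hy, hxy, rfl⟩
            · exact hl x (by simp [hx])
            · exact h0 x hx y hy hxy
          · rcases mem_Lev.mp hm with ⟨x, hx, rfl⟩ | ⟨x, hx, y, hy, hxy, rfl⟩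
            · exact hl x (by simp [hx])
            · exact h1 x hx y hy hxy
        have hLev : Lev len mt (X0 ∪ X1) = insert n0 (Lev len mt X0 ∪ Lev len mt X1) := by
          ext m
          rw [Finset.mem_insert, Finset.mem_union, mem_Lev, mem_Lev, mem_Lev]
          constructor
          · rintro (⟨x, hx, h⟩ | ⟨x, hx, y, hy, hxy, h⟩)
            · rcases Finset.mem_union.mp hx with hx | hx
              · exact Or.inr (Or.inl (Or.inl ⟨x, hx, h⟩))
              · exact Or.inr (Or.inr (Or.inl ⟨x, hx, h⟩))
            · rcases Finset.mem_union.mp hx with hx | hx <;> rcases Finset.mem_union.mp hy with hy | hy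
              · exact Or.inr (Or.inl (Or.inr ⟨x, hx, y, hy, hxy, h⟩))
              · left; rw [← h]; exact (hc x hx y hy).2
              · exact absurd (hc y hy x hx).1 (not_lt.mpr hxy.le)
              · exact Or.inr (Or.inr (Or.inr ⟨x, hx, y, hy, hxy, h⟩))
          · rintro (h | (⟨x, hx, h⟩ | ⟨x, hx, y, hy, hxy, h⟩) | (⟨x, hx, h⟩ | ⟨x, hx, y, hy, hxy, h⟩))
            · obtain ⟨x, hx⟩ := ne0
              obtain ⟨y, hy⟩ := ne1
              exact Or.inr ⟨x, by simp [hx], y, by simp [hy], (hc x hx y hy).1, by rw [(hc x hx y hy).2, h]⟩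
            · exact Or.inl ⟨x, by simp [hx], h⟩
            · exact Or.inr ⟨x, by simp [hx], y, by simp [hy], hxy, h⟩
            · exact Or.inl ⟨x, by simp [hx], h⟩
            · exact Or.inr ⟨x, by simp [hx], y, by simp [hy], hxy, h⟩
        have hn0 : n0 ∉ Lev len mt X0 ∪ Lev len mt X1 := fun h => lt_irrefl _ (big _ h)
        have cU : (Lev len mt X0 ∪ Lev len mt X1).card = 2*n+2 := by
          rw [Finset.card_union_of_disjoint hdL, r0.2, r1.2]; omega
        refine ⟨?_, ?_⟩
        swap
        · rw [hLev, Finset.card_insert_of_notMem hn0, cU]; omega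
        set L := (Lev len mt X0 ∪ Lev len mt X1).sort with hL
        have hLs : (Lev len mt (X0 ∪ X1)).sort = n0 :: L := by
          rw [hLev, Finset.sort_insert _ (fun m hm => (big m hm).le) hn0]
        have hLp : L.Pairwise (· < ·) := sort_pw _
        have hLm : ∀ m, m ∈ L ↔ m ∈ Lev len mt X0 ∨ m ∈ Lev len mt X1 := by
          intro m; rw [hL, Finset.mem_sort, Finset.mem_union]
        let P0 : ℕ → Bool := fun m => decide (m ∈ Lev len mt X0)
        let P1 : ℕ → Bool := fun m => !decide (m ∈ Lev len mt X0)
        have hP1 : ∀ m ∈ L, (P1 m = true ↔ m ∈ Lev len mt X1) := by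
          intro m hm
          have := (Finset.disjoint_left.mp hdL : ∀ ⦃a⦄, a ∈ Lev len mt X0 → a ∉ Lev len mt X1) (a := m)
          have := (hLm m).1 hm
          simp only [P1, Bool.not_eq_true', decide_eq_false_iff_not]
          tauto
        have s0 : (Lev len mt X0).sort = L.filter P0 := by
          apply sort_uniq _ _ (hLp.sublist List.filter_sublist)
          intro m
          simp only [List.mem_filter, hLm, P0, decide_eq_true_eq]
          tauto
        have s1 : (Lev len mt X1).sort = L.filter P1 := by
          apply sort_uniq _ _ (hLp.sublist List.filter_sublist)
          intro m
          rw [List.mem_filter]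
          constructor
          · rintro ⟨h1, h2⟩; exact (hP1 m h1).1 h2
          · intro h
            have h3 := (hLm m).2 (Or.inr h)
            exact ⟨h3, (hP1 m h3).2 h⟩
        have e0 : ∀ x ∈ X0, rd β len x (n0 :: L) = false :: spread (L.map P0) (rd β len x (Lev len mt X0).sort) := by
          intro x hx
          have hm : len x ∈ Lev len mt X0 := mem_Lev.mpr (Or.inl ⟨x, hx, rfl⟩)
          rw [s0, ← rd_spread β len x P0 L hLp ((hLm _).2 (Or.inl hm)) (by simp [P0, hm])]
          · simp [rd, hl x (by simp [hx]), hf x hx]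
          · intro m hm hP hlt
            have : m ∈ Lev len mt X1 := by
              have := (hLm m).1 hm
              simp only [P0, decide_eq_false_iff_not] at hP
              tauto
            exact H.other (hs x hx) h1 this hlt
        have e1 : ∀ x ∈ X1, rd β len x (n0 :: L) = true :: spread (L.map P1) (rd β len x (Lev len mt X1).sort) := by
          intro x hx
          have hm : len x ∈ Lev len mt X1 := mem_Lev.mpr (Or.inl ⟨x, hx, rfl⟩)
          have hm' := (hLm _).2 (Or.inr hm)
          rw [s1, ← rd_spread β len x P1 L hLp hm' ((hP1 _ hm').2 hm)]
          · simp [rd, hl x (by simp [hx]), ht x hx]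
          · intro m hm hP hlt
            have : m ∈ Lev len mt X0 := by
              simpa [P1] using hP
            exact H.other (fun y hy => (hs y hy x hx).symm) h0 this hlt
        have hsort : (X0 ∪ X1).sort = X0.sort ++ X1.sort := by
          apply sort_uniq
          · rw [List.pairwise_append]
            refine ⟨sort_pw _, sort_pw _, ?_⟩
            intro x hx y hy
            exact (hc x (by simpa using hx) y (by simpa using hy)).1
          · intro x; simp
        have hty : ty β len mt (X0 ∪ X1) = combine (L.map P0) (ty β len mt X0) (ty β len mt X1) := by
          rw [ty, hLs, hsort, combine, List.map_append, ty, ty, List.map_map, List.map_map]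
          congr 1
          · apply List.map_congr_left
            intro x hx
            exact e0 x (by simpa using hx)
          · apply List.map_congr_left
            intro x hx
            rw [e1 x (by simpa using hx), Function.comp, List.map_map]
            rfl
        rw [Finset.mem_biUnion]
        refine ⟨i, Finset.mem_range.mpr (by omega), ?_⟩
        rw [Finset.mem_image]
        refine ⟨(L.map P0, ty β len mt X0, ty β len mt X1), ?_, hty.symm⟩
        rw [Finset.mem_product, Finset.mem_product]
        refine ⟨mem_masks _ _ _ ?_ ?_, r0.1, r1.1⟩
        · rw [List.length_map, hL, Finset.length_sort, cU]
        · rw [count_map_filter, ← s0, Finset.length_sort, r0.2]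


theorem rd_spec (q : ℚ) (L : List ℕ) (hL : L.Pairwise (· < ·)) (hm : len q ∈ L) :
    (rd β len q L).length < L.length ∧ (∀ d, L.getD (rd β len q L).length d = len q) ∧
    ∀ i < (rd β len q L).length, ∀ d, (rd β len q L).getD i false = β q (L.getD i d) := by
  induction L with
  | nil => simp at hm
  | cons n L ih =>
    rw [List.pairwise_cons] at hL
    rcases lt_trichotomy n (len q) with h | h | h
    · have hm' : len q ∈ L := by
        rcases List.mem_cons.mp hm with h1 | h1
        · omega
        · exact h1
      obtain ⟨h1, h2, h3⟩ := ih hL.2 hm'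
      simp only [rd, h, if_true, List.length_cons]
      refine ⟨by omega, ?_, ?_⟩
      · intro d; simpa using h2 d
      · intro i hi d
        cases i with
        | zero => simp
        | succ i => simpa using h3 i (by omega) d
    · subst h
      simp [rd]
    · exfalso
      rcases List.mem_cons.mp hm with h1 | h1
      · omega
      · have := hL.1 _ h1; omega

theorem range_pre {n n' : ℕ} (f g : ℕ → Bool) (h : n ≤ n') (hfg : ∀ m < n, f m = g m) :
    (List.range n).map f <+: (List.range n').map g := by
  have h1 : (List.range n).map f = (List.range n).map g := by
    apply List.map_congr_left
    intro m hm; exact hfg m (List.mem_range.mp hm)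
  rw [h1]
  obtain ⟨j, rfl⟩ := Nat.exists_eq_add_of_le h
  rw [List.range_add, List.map_append]
  exact List.prefix_append _ _

theorem getD_sorted_mono (L : List ℕ) (hL : L.Pairwise (· < ·)) (M : ℕ) (hM : ∀ m ∈ L, m < M) :
    StrictMono (fun r => L.getD r (M + r)) := by
  apply strictMono_nat_of_lt_succ
  intro r
  rcases lt_or_ge (r+1) L.length with h | h
  · rw [List.getD_eq_getElem _ _ h, List.getD_eq_getElem _ _ (by omega)]
    exact List.pairwise_iff_getElem.mp hL r (r+1) _ _ (by omega)
  · rw [List.getD_eq_default _ _ h]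
    rcases lt_or_ge r L.length with h' | h'
    · rw [List.getD_eq_getElem _ _ h']
      have := hM _ (List.getElem_mem h')
      omega
    · rw [List.getD_eq_default _ _ h']; omega

theorem DD.env (H : DD β len mt) (X : Finset ℚ) :
    ∃ e, SE e ∧ ∀ q ∈ X, e (rd β len q (Lev len mt X).sort) = (List.range (len q)).map (β q) := by
  classical
  set L := (Lev len mt X).sort with hLdef
  have hLp : L.Pairwise (· < ·) := sort_pw _
  have hLm : ∀ m, m ∈ L ↔ m ∈ Lev len mt X := by intro m; rw [hLdef, Finset.mem_sort]
  let M := (Lev len mt X).sup id + 1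
  have hM : ∀ m ∈ L, m < M := by
    intro m hm
    have := Finset.le_sup (f := id) ((hLm m).1 hm)
    simp only [id] at this
    omega
  let N : ℕ → ℕ := fun r => L.getD r (M + r)
  have hN : StrictMono N := getD_sorted_mono L hLp M hM
  have hNL : ∀ m ∈ L, ∃ i, N i = m := by
    intro m hm
    obtain ⟨i, hi, rfl⟩ := List.getElem_of_mem hm
    exact ⟨i, List.getD_eq_getElem _ _ hi⟩
  have hrk : ∀ m, ∃ r, m ≤ N r := fun m => ⟨m, hN.id_le m⟩
  let rk : ℕ → ℕ := fun m => Nat.find (hrk m)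
  have rk1 : ∀ m, m ≤ N (rk m) := fun m => Nat.find_spec (hrk m)
  have rk2 : ∀ m r, m ≤ N r → rk m ≤ r := fun m r h => Nat.find_min' (hrk m) h
  let tr : Nd → ℚ → Prop := fun p q => ∀ i < p.length, p.getD i false = β q (N i)
  let bv : Nd → ℕ → Bool := fun p m => if N (rk m) = m then p.getD (rk m) false else
    decide (∃ q ∈ X, tr (p.take (rk m)) q ∧ β q m = true)
  let e : Nd → Nd := fun p => (List.range (N p.length)).map (bv p)
  refine ⟨e, ⟨?_, ?_⟩, ?_⟩
  · intro p i
    have h1 : e p ++ [i] = (List.range (N p.length + 1)).map (fun m => if m = N p.length then i else bv p m) := by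
      rw [List.range_succ, List.map_append]
      congr 1
      · apply List.map_congr_left
        intro m hm
        have := List.mem_range.mp hm
        rw [if_neg (by omega)]
      · simp
    rw [h1]
    apply range_pre
    · have := hN (show p.length < (p ++ [i]).length by simp)
      omega
    · intro m hm
      by_cases hme : m = N p.length
      · rw [if_pos hme]
        have : rk m = p.length := by
          apply le_antisymm (rk2 _ _ hme.le)
          have := rk1 m
          rw [hme] at this
          have := hN.le_iff_le.mp this
          rwa [hme]
        simp only [bv, this, if_pos hme.symm]
        simp
      · rw [if_neg hme]
        have hr : rk m ≤ p.length := rk2 _ _ (by omega)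
        simp only [bv]
        rw [List.take_append_of_le_length hr]
        by_cases hh : N (rk m) = m
        · rw [if_pos hh, if_pos hh]
          have : rk m < p.length := by
            rcases hr.lt_or_eq with h | h
            · exact h
            · rw [h] at hh; exact absurd hh.symm hme
          rw [List.getD_append _ _ _ _ this]
        · rw [if_neg hh, if_neg hh]
  · intro t t' h
    simp [e, h]
  · intro q hq
    have hmq : len q ∈ L := (hLm _).2 (mem_Lev.mpr (Or.inl ⟨q, hq, rfl⟩))
    obtain ⟨h1, h2, h3⟩ := rd_spec (β := β) q L hLp hmq
    set p := rd β len q L with hp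
    have hNp : N p.length = len q := h2 _
    simp only [e, hNp]
    apply List.map_congr_left
    intro m hm
    have hm := List.mem_range.mp hm
    have hr : rk m ≤ p.length := rk2 _ _ (by omega)
    have htr : ∀ i < p.length, p.getD i false = β q (N i) := fun i hi => h3 i hi _
    simp only [bv]
    by_cases hh : N (rk m) = m
    · rw [if_pos hh]
      have : rk m < p.length := by
        rcases hr.lt_or_eq with h | h
        · exact h
        · rw [h] at hh; omega
      rw [htr _ this, hh]
    · rw [if_neg hh]
      have hlt : m < N (rk m) := lt_of_le_of_ne (rk1 m) (Ne.symm hh)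
      have htk : ∀ i < rk m, (p.take (rk m)).getD i false = β q (N i) := by
        intro i hi
        rw [← htr i (by omega)]
        rw [List.getD_eq_getElem _ _ (by simp; omega), List.getD_eq_getElem _ _ (by omega)]
        simp
      have hlen : (p.take (rk m)).length = rk m := by simp; omega
      cases hb : β q m with
      | true =>
        rw [decide_eq_true_eq]
        exact ⟨q, hq, fun i hi => htk i (by omega), hb⟩
      | false =>
        rw [decide_eq_false_iff_not]
        rintro ⟨q', hq', ht', hb'⟩
        have same : ∀ i, N i ≤ m → β q' (N i) = β q (N i) := by
          intro i hi
          have : i < rk m := hN.lt_iff_lt.mp (hi.trans_lt hlt)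
          rw [← htk i this, ← ht' i (by omega)]
        rcases lt_trichotomy q q' with h | h | h
        · obtain ⟨i, hi⟩ := hNL (mt q q') ((hLm _).2 (mem_Lev.mpr (Or.inr ⟨q, hq, q', hq', h, rfl⟩)))
          have hle : mt q q' ≤ m := by
            by_contra hc
            have := H.ag q q' h m (by omega)
            simp_all
          have := same i (by omega)
          rw [hi, H.bf q q' h, H.bt q q' h] at this
          simp at this
        · subst h; simp_all
        · obtain ⟨i, hi⟩ := hNL (mt q' q) ((hLm _).2 (mem_Lev.mpr (Or.inr ⟨q', hq', q, hq, h, rfl⟩)))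
          have hle : mt q' q ≤ m := by
            by_contra hc
            have := H.ag q' q h m (by omega)
            simp_all
          have := same i (by omega)
          rw [hi, H.bf q' q h, H.bt q' q h] at this
          simp at this

theorem DD.node_llt (H : DD β len mt) {q q' : ℚ} (h : q < q') :
    Llt ((List.range (len q)).map (β q)) ((List.range (len q')).map (β q')) := by
  refine ⟨(List.range (mt q q')).map (β q), ?_, ?_⟩
  · have : (List.range (mt q q')).map (β q) ++ [false] = (List.range (mt q q' + 1)).map (β q) := by
      rw [List.range_succ, List.map_append]; simp [H.bf q q' h]
    rw [this]
    exact range_pre _ _ (H.lt1 q q' h) (fun _ _ => rfl)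
  · have : (List.range (mt q q')).map (β q) ++ [true] = (List.range (mt q q' + 1)).map (β q') := by
      rw [List.range_succ, List.map_append]; simp [H.bt q q' h]
      exact H.ag q q' h
    rw [this]
    exact range_pre _ _ (H.lt2 q q' h) (fun _ _ => rfl)

theorem devlin (n : ℕ) {κ : Type*} [Finite κ] [DecidableEq κ] (χ : List Nd → κ) :
    ∃ η : ℚ → Nd, (∀ q q', q < q' → Llt (η q) (η q')) ∧ ∃ B : Finset κ, B.card ≤ dn (2*n+1) ∧
      ∀ rs : List ℚ, rs.Pairwise (· < ·) → rs.length = n + 1 → χ (rs.map η) ∈ B := by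
  classical
  obtain ⟨β, len, mt, H⟩ := exists_DD
  obtain ⟨T, hT1, hT2⟩ := H.types n
  obtain ⟨e, he, q, hq⟩ := milliken (κ := T → κ) (2*n+1) (fun f P => χ (P.1.map f))
  refine ⟨fun x => e ((List.range (len x)).map (β x)), fun x y h => he.llt (H.node_llt h), 
    Finset.univ.image q, ?_, ?_⟩
  · refine Finset.card_image_le.trans ?_
    simpa using hT1
  · intro rs hrs hl
    have hX : (rs.toFinset).sort = rs := sort_uniq _ _ hrs (by simp)
    have hc : rs.toFinset.card = n + 1 := by rw [← Finset.length_sort (· ≤ ·), hX, hl]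
    obtain ⟨hm, hLc⟩ := hT2 _ hc
    obtain ⟨e', he', h'⟩ := H.env rs.toFinset
    have h1 := congrFun (hq e' he') ⟨_, hm⟩
    have h2 : (ty β len mt rs.toFinset).map (restr (2*n+1) (e ∘ e')) =
        rs.map (fun x => e ((List.range (len x)).map (β x))) := by
      rw [ty, hX, List.map_map]
      apply List.map_congr_left
      intro x hx
      have hx' : x ∈ rs.toFinset := by simpa using hx
      have h3 := rd_spec (β := β) (len := len) x (Lev len mt rs.toFinset).sort (sort_pw _)
        (by rw [Finset.mem_sort]; exact mem_Lev.mpr (Or.inl ⟨x, hx', rfl⟩))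
      rw [Finset.length_sort, hLc] at h3
      simp only [Function.comp, restr, if_pos h3.1]
      rw [h' x hx']
    rw [← h2, Finset.mem_image]
    exact ⟨⟨_, hm⟩, Finset.mem_univ _, h1.symm⟩

end Devlin

section Tan

theorem tan_dn (n : ℕ) : iteratedDeriv n Real.tan 0 = (dn n : ℝ) := by
  induction n using Nat.strong_induction_on with
  | _ n ih =>
    cases n with
    | zero => simp [dn_zero]
    | succ n =>
      have hcos : ∀ᶠ x in nhds (0:ℝ), Real.cos x ≠ 0 :=
        Real.continuous_cos.continuousAt.eventually_ne (by simp)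
      have hev : deriv Real.tan =ᶠ[nhds 0] fun x => 1 + (Real.tan * Real.tan) x := by
        filter_upwards [hcos] with x hx
        rw [(Real.hasDerivAt_tan hx).deriv, Pi.mul_apply, Real.tan_eq_sin_div_cos]
        field_simp
        rw [add_comm]
        exact (Real.sin_sq_add_cos_sq x).symm
      have hcd : ∀ m : ℕ, ContDiffAt ℝ m Real.tan 0 := fun m => Real.contDiffAt_tan.mpr (by simp)
      rw [iteratedDeriv_succ', hev.iteratedDeriv_eq n]
      have hmul := iteratedDeriv_mul (hcd n) (hcd n)
      have hsum : iteratedDeriv n (Real.tan * Real.tan) 0 =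
          ((∑ j ∈ Finset.range (n+1), n.choose j * dn j * dn (n - j) : ℕ) : ℝ) := by
        rw [hmul]
        push_cast
        apply Finset.sum_congr rfl
        intro j hj
        have := Finset.mem_range.mp hj
        rw [ih j (by omega), ih (n-j) (by omega)]
      rcases Nat.eq_zero_or_pos n with h0 | h0
      · subst h0
        simp [dn_succ, dn_zero]
      · rw [iteratedDeriv_const_add h0, hsum, dn_succ, if_neg (by omega), zero_add]

theorem dn_pos (n : ℕ) : 0 < dn (2*n+1) := by
  induction n with
  | zero => simp [dn_succ, dn_zero]
  | succ n ih =>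
    have h1 : dn 1 = 1 := by simp [dn_succ, dn_zero]
    have h := dn_sub n
    have h2 := Finset.single_le_sum (f := fun i => (2*n+2).choose (2*i+1) * dn (2*i+1) * dn (2*(n-i)+1))
      (fun i _ => Nat.zero_le _) (Finset.mem_range.mpr (Nat.succ_pos n))
    simp only [Nat.mul_zero, Nat.zero_add, h1, Nat.sub_zero, Nat.choose_one_right] at h2
    have h3 : 0 < (2*n+2) * 1 * dn (2*n+1) := by positivity
    have : 2 * (n+1) + 1 = 2*n+3 := by omega
    rw [this]; exact h3.trans_le (h2.trans h)

end Tan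

section Red

variable {b : ℕ}

def idx (n : ℕ) (z : ℕ → Fin b) : ℕ :=
  match n with
  | 0 => 0
  | n + 1 => b * idx n z + (z n : ℕ)

theorem idx_succ (n : ℕ) (z : ℕ → Fin b) : idx (n+1) z = b * idx n z + (z n : ℕ) := rfl

theorem idx_zero (z : ℕ → Fin b) : idx 0 z = 0 := rfl

theorem idx_lt (n : ℕ) (z : ℕ → Fin b) : idx n z < b ^ n := by
  induction n with
  | zero => simp [idx_zero]
  | succ n ih =>
    rw [idx_succ, pow_succ]
    have := (z n).2
    nlinarith

theorem idx_div (n : ℕ) (z : ℕ → Fin b) : idx (n+1) z / b = idx n z := by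
  have := (z n).2
  rw [idx_succ, Nat.mul_add_div (by omega), Nat.div_eq_of_lt this, add_zero]

theorem idx_mod (n : ℕ) (z : ℕ → Fin b) : idx (n+1) z % b = z n := by
  have := (z n).2
  rw [idx_succ, Nat.mul_add_mod, Nat.mod_eq_of_lt this]

theorem idx_inj (n : ℕ) (z z' : ℕ → Fin b) (h : idx n z = idx n z') : ∀ m < n, z m = z' m := by
  induction n with
  | zero => intro m hm; omega
  | succ n ih =>
    intro m hm
    rcases Nat.lt_succ_iff_lt_or_eq.mp hm with h1 | h1
    · apply ih _ m h1
      rw [← idx_div n z, ← idx_div n z', h]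
    · subst h1
      apply Fin.ext
      rw [← idx_mod m z, ← idx_mod m z', h]

theorem idx_congr (n : ℕ) (z z' : ℕ → Fin b) (h : ∀ m < n, z m = z' m) : idx n z = idx n z' := by
  induction n with
  | zero => rfl
  | succ n ih => rw [idx_succ, idx_succ, ih (fun m hm => h m (by omega)), h n (by omega)]

theorem idx_ext (z z' : ℕ → Fin b) (h : ∀ n, idx n z = idx n z') : z = z' := by
  funext m
  exact idx_inj (m+1) z z' (h _) m (by omega)

theorem idx_down {m n : ℕ} (hmn : m ≤ n) {z z' : ℕ → Fin b} (h : idx n z ≤ idx n z') : idx m z ≤ idx m z' := by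
  induction n, hmn using Nat.le_induction with
  | base => exact h
  | succ n _ ih =>
    apply ih
    rw [← idx_div n z, ← idx_div n z']
    exact Nat.div_le_div_right h

theorem idx_up {m n : ℕ} (hmn : m ≤ n) {z z' : ℕ → Fin b} (h : idx m z < idx m z') : idx n z < idx n z' := by
  by_contra hc
  have := idx_down hmn (not_lt.mp hc)
  omega

theorem lex_total (z z' : ℕ → Fin b) : lexLE b z z' ∨ lexLT b z' z := by
  by_cases h : z = z'
  · exact Or.inl (Or.inl h)
  · have h' := Function.ne_iff.mp h
    classical
    have h1 := Nat.find_spec h'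
    have h2 : ∀ m < Nat.find h', z m = z' m := fun m hm => by
      have := Nat.find_min h' hm
      simpa using this
    rcases lt_or_gt_of_ne h1 with h3 | h3
    · exact Or.inl (Or.inr ⟨_, h2, h3⟩)
    · exact Or.inr ⟨_, fun m hm => (h2 m hm).symm, h3⟩

theorem idx_lt_of_lexLT {z z' : ℕ → Fin b} (h : lexLT b z z') : ∃ m, ∀ n, m ≤ n → idx n z < idx n z' := by
  obtain ⟨m, h1, h2⟩ := h
  refine ⟨m+1, fun n hn => idx_up hn ?_⟩
  rw [idx_succ, idx_succ, idx_congr m z z' h1]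
  have : (z m : ℕ) < z' m := h2
  omega

theorem idx_mono {z z' : ℕ → Fin b} (h : lexLE b z z') (n : ℕ) : idx n z ≤ idx n z' := by
  rcases h with rfl | h
  · exact le_rfl
  · obtain ⟨m, hm⟩ := idx_lt_of_lexLT h
    exact idx_down (le_max_left n m) (hm _ (le_max_right n m)).le

theorem lex_of_idx {z z' : ℕ → Fin b} (h : ∀ n, idx n z ≤ idx n z') : lexLE b z z' := by
  rcases lex_total z z' with h1 | h1
  · exact h1
  · obtain ⟨m, hm⟩ := idx_lt_of_lexLT h1
    have := h m; have := hm m le_rfl; omega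

theorem lex_of_idx_lt {z z' : ℕ → Fin b} {n : ℕ} (h : idx n z < idx n z') : lexLE b z z' := by
  rcases lex_total z z' with h1 | h1
  · exact h1
  · have := idx_mono (Or.inr h1) n; omega

theorem idx_seq (hb : 0 < b) (a : ℕ → ℕ) (h0 : a 0 = 0) (ha : ∀ n, a (n+1) / b = a n) (n : ℕ) :
    idx n (fun n => (⟨a (n+1) % b, Nat.mod_lt _ hb⟩ : Fin b)) = a n := by
  induction n with
  | zero => rw [idx_zero, h0]
  | succ n ih =>
    rw [idx_succ, ih, ← ha n]
    exact Nat.div_add_mod _ _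

theorem idx_surj (hb : 0 < b) (n u : ℕ) (hu : u < b ^ n) : ∃ z : ℕ → Fin b, idx n z = u := by
  refine ⟨_, (idx_seq hb (fun m => u * b ^ m / b ^ n) ?_ ?_ n).trans ?_⟩
  · simpa using Nat.div_eq_of_lt hu
  · intro m
    rw [Nat.div_div_eq_div_mul, pow_succ, ← mul_assoc]
    exact Nat.mul_div_mul_right _ _ hb
  · exact Nat.mul_div_cancel _ (pow_pos hb n)

theorem idx_cont (n : ℕ) : Continuous (fun z : ℕ → Fin b => idx n z) := by
  induction n with
  | zero => exact continuous_const
  | succ n ih =>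
    simp only [idx_succ]
    have : Continuous (fun z : ℕ → Fin b => ((z n : Fin b) : ℕ)) :=
      (continuous_of_discreteTopology (f := fun i : Fin b => (i : ℕ))).comp (continuous_apply n)
    exact (continuous_const.mul ih).add this

/-- point attached to a node -/
def pt (hb : 2 ≤ b) (t : Nd) : ℕ → Fin b := fun i => ⟨(t.getD i false).toNat, by
  have := Bool.toNat_le (t.getD i false); omega⟩

def Cc (hb : 2 ≤ b) (t : Nd) : Set (ℕ → Fin b) := {x | idx (t.length + 1) x ≤ idx (t.length + 1) (pt hb t)}

theorem pt_llt (hb : 2 ≤ b) {t t' : Nd} (h : Llt t t') : ∃ n, n ≤ t.length ∧ n ≤ t'.length ∧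
    idx n (pt hb t) < idx n (pt hb t') := by
  obtain ⟨r, h1, h2⟩ := h
  refine ⟨r.length + 1, by simpa using h1.length_le, by simpa using h2.length_le, ?_⟩
  obtain ⟨s, rfl⟩ := h1
  obtain ⟨s', rfl⟩ := h2
  rw [idx_succ, idx_succ, idx_congr r.length _ (pt hb (r ++ [true] ++ s'))]
  · simp [pt]
  · intro m hm
    simp [pt, List.getElem?_append_left hm]

theorem Cc_llt (hb : 2 ≤ b) {t t' : Nd} (h : Llt t t') : Cc hb t ⊆ Cc hb t' ∧ ∃ x ∈ Cc hb t', x ∉ Cc hb t := by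
  obtain ⟨n, h1, h2, h3⟩ := pt_llt hb h
  refine ⟨?_, pt hb t', le_refl (idx _ _), ?_⟩
  · intro x hx
    have := idx_down (show n ≤ t.length + 1 by omega) hx
    exact (idx_up (show n ≤ t'.length + 1 by omega) (this.trans_lt h3)).le
  · intro hx
    have := idx_down (show n ≤ t.length + 1 by omega) hx
    omega

theorem Cc_clopen (hb : 2 ≤ b) (t : Nd) : IsClopen (Cc hb t) :=
  (isClopen_discrete (Set.Iic (idx (t.length+1) (pt hb t)))).preimage (idx_cont _)

theorem Cc_down (hb : 2 ≤ b) (t : Nd) {x y : ℕ → Fin b} (h : lexLE b x y) (hy : y ∈ Cc hb t) : x ∈ Cc hb t :=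
  (idx_mono h _).trans hy

/-- nested compactness -/
theorem nested {Z : Type*} [TopologicalSpace Z] [CompactSpace Z] (S : ℕ → Set Z) (h1 : ∀ n, S (n+1) ⊆ S n)
    (h2 : ∀ n, (S n).Nonempty) (h3 : ∀ n, IsClosed (S n)) : ∃ x, ∀ n, x ∈ S n := by
  obtain ⟨x, hx⟩ := IsCompact.nonempty_iInter_of_sequence_nonempty_isCompact_isClosed S h1 h2 (h3 0).isCompact h3
  exact ⟨x, Set.mem_iInter.mp hx⟩

theorem exists_h (hb : 2 ≤ b) (C : ℚ → Set (ℕ → Fin b)) (hC1 : ∀ q, IsClopen (C q))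
    (hC2 : ∀ q x y, lexLE b x y → y ∈ C q → x ∈ C q)
    (hC3 : ∀ q q', q < q' → C q ⊆ C q' ∧ ∃ x ∈ C q', x ∉ C q) :
    ∃ h, CSur b h ∧ ∀ n w x, 0 < w → w < b ^ n → (w ≤ idx n (h x) ↔ x ∉ C ((w : ℚ) / (b:ℚ) ^ n)) := by
  classical
  have hb0 : (0 : ℚ) < b := by exact_mod_cast (by omega : 0 < b)
  let N : ℕ → (ℕ → Fin b) → ℕ := fun n x => Nat.findGreatest (fun v => x ∉ C ((v : ℚ) / (b:ℚ) ^ n)) (b ^ n - 1)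
  have hpos : ∀ n, 0 < b ^ n := fun n => pow_pos (by omega) n
  have hN : ∀ n w x, w ≤ N n x ↔ (w = 0 ∨ (w < b ^ n ∧ x ∉ C ((w : ℚ) / (b:ℚ) ^ n))) := by
    intro n w x
    have := hpos n
    constructor
    · intro h
      rcases Nat.eq_zero_or_pos w with h0 | h0
      · exact Or.inl h0
      · right
        have h1 : N n x ≠ 0 := by omega
        have h2 := Nat.findGreatest_of_ne_zero (P := fun v : ℕ => x ∉ C ((v : ℚ) / (b:ℚ) ^ n)) (n := b^n - 1) rfl h1
        have h3 : N n x ≤ b ^ n - 1 := Nat.findGreatest_le _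
        refine ⟨by omega, fun hx => h2 ?_⟩
        rcases h.lt_or_eq with h4 | h4
        · refine (hC3 _ _ ?_).1 hx
          apply div_lt_div_of_pos_right _ (pow_pos hb0 n)
          show (w:ℚ) < ((N n x : ℕ) : ℚ)
          exact Nat.cast_lt.mpr h4
        · rw [h4] at hx; exact hx
    · rintro (h | ⟨h1, h2⟩)
      · omega
      · exact Nat.le_findGreatest (by omega) h2
  have hN0 : ∀ x, N 0 x = 0 := by
    intro x
    have : N 0 x ≤ b ^ 0 - 1 := Nat.findGreatest_le _
    simpa using this
  have hNd : ∀ x n, N (n+1) x / b = N n x := by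
    intro x n
    apply eq_of_forall_le_iff
    intro w
    rw [Nat.le_div_iff_mul_le (by omega), hN, hN]
    have e1 : w * b = 0 ↔ w = 0 := by
      constructor
      · intro h; rcases Nat.mul_eq_zero.mp h with h | h <;> omega
      · rintro rfl; simp
    have e2 : w * b < b ^ (n+1) ↔ w < b ^ n := by
      rw [pow_succ]; exact Nat.mul_lt_mul_right (by omega)
    have e3 : ((w * b : ℕ) : ℚ) / (b:ℚ) ^ (n+1) = (w : ℚ) / (b:ℚ) ^ n := by
      push_cast
      rw [pow_succ, mul_div_mul_right _ _ hb0.ne']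
    rw [e1, e2, e3]
  let h : (ℕ → Fin b) → (ℕ → Fin b) := fun x n => ⟨N (n+1) x % b, Nat.mod_lt _ (by omega)⟩
  have hidx : ∀ n x, idx n (h x) = N n x := fun n x => idx_seq (by omega) (fun n => N n x) (hN0 x) (hNd x) n
  have hcN : ∀ n, Continuous (N n) := by
    intro n
    rw [continuous_discrete_rng]
    intro w
    have hcl : ∀ w, IsClopen {x | w ≤ N n x} := by
      intro w
      simp only [hN]
      rcases Nat.eq_zero_or_pos w with h0 | h0
      · simp [h0]
        exact isClopen_univ
      · by_cases h1 : w < b ^ n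
        · have : {x | w = 0 ∨ (w < b ^ n ∧ x ∉ C ((w : ℚ) / (b:ℚ) ^ n))} = (C ((w : ℚ) / (b:ℚ) ^ n))ᶜ := by
            ext x; simp [h1]; omega
          rw [this]; exact (hC1 _).compl
        · have : {x | w = 0 ∨ (w < b ^ n ∧ x ∉ C ((w : ℚ) / (b:ℚ) ^ n))} = ∅ := by
            ext x; simp [h1]; omega
          rw [this]; exact isClopen_empty
    have : N n ⁻¹' {w} = {x | w ≤ N n x} \ {x | w + 1 ≤ N n x} := by
      ext x; simp; omega
    rw [this]
    exact ((hcl w).diff (hcl (w+1))).isOpen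
  refine ⟨h, ⟨?_, ?_, ?_⟩, ?_⟩
  · apply continuous_pi
    intro n
    exact (continuous_of_discreteTopology (f := fun m : ℕ => (⟨m % b, Nat.mod_lt _ (by omega)⟩ : Fin b))).comp (hcN (n+1))
  · intro y
    obtain ⟨x, hx⟩ := nested (fun n => {x | N n x = idx n y}) (by
        intro n x hx
        simp only [Set.mem_setOf_eq] at hx ⊢
        rw [← hNd x n, ← idx_div n y, hx]) (by
        intro n
        have hu := idx_lt n y
        set u := idx n y
        obtain ⟨x, hx1, hx2⟩ := (hC3 ((u : ℚ) / (b:ℚ) ^ n) (((u + 1 : ℕ) : ℚ) / (b:ℚ) ^ n) (by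
          apply div_lt_div_of_pos_right _ (pow_pos hb0 n)
          push_cast; linarith)).2
        refine ⟨x, ?_⟩
        have h1 := (hN n u x).2 (Or.inr ⟨hu, hx2⟩)
        have h2 : ¬ (u + 1 ≤ N n x) := by
          rw [hN]
          rintro (h | h)
          · omega
          · exact h.2 hx1
        show N n x = u
        omega) (by
        intro n
        exact isClosed_eq (hcN n) continuous_const)
    refine ⟨x, idx_ext _ _ fun n => ?_⟩
    rw [hidx]; exact hx n
  · intro x y hxy
    apply lex_of_idx
    intro n
    rw [hidx, hidx, hN]
    rcases (hN n (N n x) x).1 le_rfl with h1 | h1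
    · exact Or.inl h1
    · exact Or.inr ⟨h1.1, fun hy => h1.2 (hC2 _ _ _ hxy hy)⟩
  · intro n w x hw hw'
    rw [hidx, hN]
    constructor
    · rintro (h | h)
      · omega
      · exact h.2
    · intro h; exact Or.inr ⟨hw', h⟩

theorem exists_mod (hb : 2 ≤ b) (k : ℕ) (f : (ℕ → Fin b) → (ℕ → Fin b)) (hf : Continuous f) :
    ∃ n, ∀ z z', idx n z = idx n z' → idx k (f z) = idx k (f z') := by
  by_contra hc
  push Not at hc
  have hg : Continuous (fun z => idx k (f z)) := (idx_cont k).comp hf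
  obtain ⟨⟨z, z'⟩, hz⟩ := nested (Z := (ℕ → Fin b) × (ℕ → Fin b))
    (fun n => {p | idx n p.1 = idx n p.2 ∧ idx k (f p.1) ≠ idx k (f p.2)}) (by
      rintro n ⟨z, z'⟩ ⟨h1, h2⟩
      refine ⟨?_, h2⟩
      simp only at h1 ⊢
      rw [← idx_div n z, ← idx_div n z', h1]) (by
      intro n
      obtain ⟨z, z', h⟩ := hc n
      exact ⟨(z, z'), h⟩) (by
      intro n
      apply IsClosed.inter
      · exact isClosed_eq ((idx_cont n).comp continuous_fst) ((idx_cont n).comp continuous_snd)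
      · have hcont : Continuous (fun p : (ℕ → Fin b) × (ℕ → Fin b) => (idx k (f p.1), idx k (f p.2))) :=
          (hg.comp continuous_fst).prodMk (hg.comp continuous_snd)
        exact (isClosed_discrete {p : ℕ × ℕ | p.1 ≠ p.2}).preimage hcont)
  have : z = z' := idx_ext _ _ (fun n => (hz n).1)
  subst this
  exact (hz 0).2 rfl

theorem exists_thr (hb : 2 ≤ b) (k : ℕ) (f : (ℕ → Fin b) → (ℕ → Fin b)) (hf : CSur b f) :
    ∃ n, ∃ y : ℕ → ℕ, (∀ w, 0 < w → w < b ^ k → 0 < y w ∧ y w < b ^ n ∧ ∀ z, w ≤ idx k (f z) ↔ y w ≤ idx n z) ∧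
      ∀ w w', 0 < w → w < w' → w' < b ^ k → y w < y w' := by
  classical
  obtain ⟨n, hn⟩ := exists_mod hb k f hf.1
  have hex : ∀ u, u < b ^ k → ∃ z, idx k (f z) = u := by
    intro u hu
    obtain ⟨x, hx⟩ := idx_surj (by omega) k u hu
    obtain ⟨z, rfl⟩ := hf.2.1 x
    exact ⟨z, hx⟩
  have h1 : ∀ w, ∃ v, 0 < w → w < b ^ k → 0 < v ∧ v < b ^ n ∧ ∀ z, w ≤ idx k (f z) ↔ v ≤ idx n z := by
    intro w
    by_cases hw : 0 < w ∧ w < b ^ k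
    swap
    · exact ⟨0, fun h1 h2 => absurd ⟨h1, h2⟩ hw⟩
    have hne : ∃ u, ∃ z, w ≤ idx k (f z) ∧ idx n z = u := by
      obtain ⟨z, hz⟩ := hex w hw.2
      exact ⟨_, z, hz.ge, rfl⟩
    obtain ⟨z0, hz0, hz1⟩ := Nat.find_spec hne
    have hmin : ∀ z, w ≤ idx k (f z) → Nat.find hne ≤ idx n z := fun z hz => Nat.find_min' hne ⟨z, hz, rfl⟩
    set v := Nat.find hne
    have hiff : ∀ z, w ≤ idx k (f z) ↔ v ≤ idx n z := by
      intro z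
      refine ⟨hmin z, fun h => ?_⟩
      rcases h.lt_or_eq with h2 | h2
      · exact hz0.trans (idx_mono (hf.2.2 _ _ (lex_of_idx_lt (by rw [hz1]; exact h2))) k)
      · rw [← hn z0 z (by rw [hz1, h2])]; exact hz0
    refine ⟨v, fun _ _ => ⟨?_, ?_, hiff⟩⟩
    · by_contra hc
      obtain ⟨z, hz⟩ := hex 0 (pow_pos (by omega) k)
      have := (hiff z).2 (by omega)
      omega
    · rw [← hz1]; exact idx_lt n z0
  choose y hy using h1
  refine ⟨n, y, hy, ?_⟩
  intro w w' hw hww hw'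
  obtain ⟨z, hz⟩ := hex w (by omega)
  have h2 := ((hy w hw (by omega)).2.2 z).1 hz.ge
  have h3 : ¬ (y w' ≤ idx n z) := fun h => by
    have := ((hy w' (by omega) hw').2.2 z).2 h
    omega
  omega

theorem countP_range_lt (l v : ℕ) : (List.range l).countP (fun i => decide (i < v)) = min l v := by
  induction l with
  | zero => simp
  | succ l ih =>
    rw [List.range_succ, List.countP_append, ih]
    by_cases h : l < v
    · simp [h]; omega
    · simp [h]; omega

theorem rhoB_le (k : ℕ) (x y : ℕ → Fin b) (h : ∀ m < k, x m = y m) : rhoB b x y ≤ (2:ℝ) ^ (-(k:ℤ)) := by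
  unfold rhoB
  split_ifs with hxy
  · positivity
  · apply zpow_le_zpow_right₀ (by norm_num)
    have : k ≤ Nat.find (Function.ne_iff.mp hxy) := by
      by_contra hc
      exact Nat.find_spec (Function.ne_iff.mp hxy) (h _ (by omega))
    simp only [neg_le_neg_iff, Nat.cast_le]
    convert this

theorem kOf_lt (ε : ℝ) (hε : 0 < ε) : (2:ℝ) ^ (-(kOf ε:ℤ)) < ε := by
  have h1 : Real.logb 2 (1/ε) < (kOf ε : ℝ) := by
    unfold kOf
    push_cast
    exact Nat.lt_floor_add_one _
  rw [Real.logb_lt_iff_lt_rpow (by norm_num) (by positivity), Real.rpow_natCast] at h1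
  rw [zpow_neg, zpow_natCast, inv_lt_comm₀ (by positivity) hε, ← one_div]
  exact h1

theorem CSur.comp {f g : (ℕ → Fin b) → (ℕ → Fin b)} (hf : CSur b f) (hg : CSur b g) : CSur b (f ∘ g) :=
  ⟨hf.1.comp hg.1, hf.2.1.comp hg.2.1, fun x y h => hf.2.2 _ _ (hg.2.2 _ _ h)⟩

theorem reduction (hb : 2 ≤ b) (k : ℕ) (hk : 0 < k) (n : ℕ) (hn : b ^ k - 1 = n + 1) (K : ℕ)
    (c : ((ℕ → Fin b) → (ℕ → Fin b)) → Fin K) :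
    ∃ h, CSur b h ∧ ∃ B : Finset (Fin K), B.card ≤ dn (2*n+1) ∧
      ∀ f, CSur b f → ∃ g, CSur b g ∧ (∀ x, idx k (g x) = idx k (f (h x))) ∧ c g ∈ B := by
  classical
  let Q : List Nd → ((ℕ → Fin b) → (ℕ → Fin b)) → Prop := fun ns g =>
    CSur b g ∧ ∀ x, idx k (g x) = ns.countP (fun t => decide (x ∉ Cc hb t))
  let χ : List Nd → Fin K := fun ns => if h : ∃ g, Q ns g then c h.choose else c id
  obtain ⟨η, hη, B, hB, hχ⟩ := devlin n χ
  obtain ⟨h, hh, hh2⟩ := exists_h hb (fun q => Cc hb (η q)) (fun q => Cc_clopen hb _)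
    (fun q x y => Cc_down hb _) (fun q q' hq => Cc_llt hb (hη q q' hq))
  refine ⟨h, hh, B, hB, ?_⟩
  intro f hf
  obtain ⟨m, y, hy1, hy2⟩ := exists_thr hb k f hf
  have hb0 : (0 : ℚ) < b := by exact_mod_cast (by omega : 0 < b)
  let rs : List ℚ := (List.range (n+1)).map (fun i => (y (i+1) : ℚ) / (b:ℚ) ^ m)
  have hrs : rs.Pairwise (· < ·) := by
    rw [List.pairwise_map]
    refine List.pairwise_lt_range.imp_of_mem ?_
    intro i j hi hj hij
    have hj := List.mem_range.mp hj
    apply div_lt_div_of_pos_right _ (pow_pos hb0 m)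
    exact_mod_cast hy2 (i+1) (j+1) (by omega) (by omega) (by omega)
  have hB' := hχ rs hrs (by simp [rs])
  have hQ : Q (rs.map η) (f ∘ h) := by
    refine ⟨CSur.comp hf hh, fun x => ?_⟩
    have hlt := idx_lt k (f (h x))
    have e : (rs.map η).countP (fun t => decide (x ∉ Cc hb t)) =
        (List.range (n+1)).countP (fun i => decide (i < idx k (f (h x)))) := by
      rw [List.countP_map, List.countP_map]
      apply List.countP_congr
      intro i hi
      have hi := List.mem_range.mp hi
      have h1 := hy1 (i+1) (by omega) (by omega)
      have h2 := hh2 m (y (i+1)) x h1.1 h1.2.1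
      have h3 := h1.2.2 (h x)
      simp only [Function.comp, decide_eq_true_eq]
      rw [← h2, ← h3]
      exact Iff.rfl
    rw [e, countP_range_lt]
    simp only [Function.comp]
    omega
  have hex : ∃ g, Q (rs.map η) g := ⟨_, hQ⟩
  refine ⟨hex.choose, hex.choose_spec.1, ?_, ?_⟩
  · intro x
    rw [hex.choose_spec.2 x, ← hQ.2 x]; rfl
  · have : χ (rs.map η) = c hex.choose := by simp only [χ, dif_pos hex]
    rw [← this]; exact hB'

theorem final (b : ℕ) (hb : 2 ≤ b) (ε : ℝ) (hε : 0 < ε) :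
    ∃ t : ℕ, 0 < t ∧ (t : ℝ) = oddTangent (b ^ kOf ε - 1) ∧
      ∀ K : ℕ, 0 < K → ∀ c : ((ℕ → Fin b) → (ℕ → Fin b)) → Fin K,
        ∃ h, CSur b h ∧ ∃ B : Finset (Fin K), B.card ≤ t ∧
          ∀ f, CSur b f → ∃ g, CSur b g ∧
            rhoInf b g (f ∘ h) < ε ∧ c g ∈ B := by
  have hk : 0 < kOf ε := by unfold kOf; omega
  have hbk : 2 ≤ b ^ kOf ε := hb.trans (Nat.le_self_pow (by omega) b)
  obtain ⟨n, hn⟩ : ∃ n, b ^ kOf ε - 1 = n + 1 := ⟨b ^ kOf ε - 2, by omega⟩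
  refine ⟨dn (2*n+1), dn_pos n, ?_, ?_⟩
  · rw [hn, oddTangent, tan_dn]
    congr 2
  · intro K _ c
    obtain ⟨h, hh, B, hB, H⟩ := reduction hb (kOf ε) hk n hn K c
    refine ⟨h, hh, B, hB, ?_⟩
    intro f hf
    obtain ⟨g, hg, h1, h2⟩ := H f hf
    refine ⟨g, hg, ?_, h2⟩
    have : Nonempty (ℕ → Fin b) := ⟨fun _ => ⟨0, by omega⟩⟩
    refine lt_of_le_of_lt (ciSup_le fun x => ?_) (kOf_lt ε hε)
    exact rhoB_le _ _ _ (idx_inj _ _ _ (h1 x))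

end Red

end Osc

/-- main theorem: approximate Ramsey degree `t_{b^k - 1}` for finite
colorings of `C↑_sur(b^ω)`, where `k = ⌊log₂(1/ε)⌋ + 1` and `t_l` is the `l`-th odd
tangent number. -/
theorem main_oscillation_stability (b : ℕ) (hb : 2 ≤ b) (ε : ℝ) (hε : 0 < ε) :
    ∃ t : ℕ, 0 < t ∧ (t : ℝ) = oddTangent (b ^ kOf ε - 1) ∧
      ∀ K : ℕ, 0 < K → ∀ c : ((ℕ → Fin b) → (ℕ → Fin b)) → Fin K,
        ∃ h, CSur b h ∧ ∃ B : Finset (Fin K), B.card ≤ t ∧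
          ∀ f, CSur b f → ∃ g, CSur b g ∧
            rhoInf b g (f ∘ h) < ε ∧ c g ∈ B := by
  exact Osc.final b hb ε hε
end
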